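/- Let Z be a compact subset of the unit sphere S² of ℝ³ and let 𝔛 be a Z-valued switched Bebutov shift. If φ ∈ 𝔛 is recurrent with respect to the shift semiflow on 𝔛, then there exists a preperiodic element χ ∈ 𝔛 with χ(0) = φ(0). If moreover φ is injective, then χ may be chosen to be a constant function. -/

import Mathlib

open scoped NNReal
open Filter Topology

/-- The shift semiflow `σ^τ` on `C([0,∞), Z)`. -/
noncomputable def bebShift {Z : Type*} [TopologicalSpace Z] (τ : ℝ≥0) (φ : C(ℝ≥0, Z)) :
    C(ℝ≥0, Z) :=
  φ.comp ⟨fun t => t + τ, continuous_id.add continuous_const⟩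

/-- A `Z`-valued switched Bebutov shift: a compact, shift-invariant subset of `C([0,∞), Z)`
(with the compact-open topology) satisfying the switching axiom. -/
def IsSwitchedBebutovShift {Z : Type*} [TopologicalSpace Z] (X : Set C(ℝ≥0, Z)) : Prop :=
  IsCompact X ∧
  (∀ φ ∈ X, ∀ τ : ℝ≥0, bebShift τ φ ∈ X) ∧
  (∀ φ₁ ∈ X, ∀ φ₂ ∈ X, ∀ τ : ℝ≥0, 0 < τ → φ₁ τ = φ₂ τ →
    ∀ ψ : C(ℝ≥0, Z), (∀ t, t ≤ τ → ψ t = φ₁ t) → (∀ t, τ ≤ t → ψ t = φ₂ t) → ψ ∈ X)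

/-- `φ` is recurrent with respect to the shift semiflow: there is a sequence `tₙ → ∞`
with `σ^{tₙ}φ → φ` in the compact-open topology. -/
def IsShiftRecurrent {Z : Type*} [TopologicalSpace Z] (φ : C(ℝ≥0, Z)) : Prop :=
  ∃ t : ℕ → ℝ≥0, Tendsto t atTop atTop ∧ Tendsto (fun n => bebShift (t n) φ) atTop (𝓝 φ)

theorem exists_continuous_log {X : Type*} [TopologicalSpace X] [SimplyConnectedSpace X]
    [LocallyPathConnectedSpace X] {f : X → ℂ} (hf : Continuous f) (h0 : ∀ x, f x ≠ 0) :
    ∃ l : X → ℂ, Continuous l ∧ ∀ x, Complex.exp (l x) = f x := by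
  obtain ⟨x₀⟩ : Nonempty X := inferInstance
  obtain ⟨F, ⟨-, hF⟩, -⟩ := Complex.isCoveringMapOn_exp.existsUnique_continuousMap_lifts
    (A := X) (e₀ := Complex.log (f x₀)) (a₀ := x₀) ⟨f, hf⟩
    (by simp [Complex.exp_log (h0 x₀)]) (fun a => by simpa using h0 a)
  exact ⟨F, F.continuous, fun x => congrFun hF x⟩

theorem exists_continuousOn_log_Icc {f : ℝ → ℂ} {x y : ℝ} (hxy : x ≤ y)
    (hf : ContinuousOn f (Set.Icc x y)) (h0 : ∀ r ∈ Set.Icc x y, f r ≠ 0) :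
    ∃ l : ℝ → ℂ, ContinuousOn l (Set.Icc x y) ∧ ∀ r ∈ Set.Icc x y, Complex.exp (l r) = f r := by
  obtain ⟨l, hl, he⟩ := exists_continuous_log (f := Set.IccExtend hxy ((Set.Icc x y).domRestrict f))
    (hf.domRestrict.Icc_extend') (fun r => h0 _ (Set.projIcc x y hxy r).2)
  refine ⟨l, hl.continuousOn, fun r hr => ?_⟩
  rw [he, Set.IccExtend_of_mem _ _ hr]; rfl

/-- A continuous function whose exponential is identically `1` is constant on connected sets. -/
theorem IsPreconnected.eq_of_exp_eq_one {X : Type*} [TopologicalSpace X] {S : Set X} {f : X → ℂ}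
    (hS : IsPreconnected S) (hf : ContinuousOn f S) (h : ∀ x ∈ S, Complex.exp (f x) = 1)
    {x y : X} (hx : x ∈ S) (hy : y ∈ S) : f x = f y := by
  refine hS.constant_of_mapsTo
    (T := (AddSubgroup.zmultiples (2 * Real.pi * Complex.I : ℂ) : Set ℂ)) ?_ hf ?_ hx hy
  · exact ⟨NormedSpace.discreteTopology_zmultiples _⟩
  · intro z hz
    obtain ⟨n, hn⟩ := Complex.exp_eq_one_iff.1 (h z hz)
    exact ⟨n, by simp [hn]⟩

theorem eq_zero_of_exp_eq_one_of_norm_lt {w : ℂ} (h : Complex.exp w = 1) (hw : ‖w‖ < 6) :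
    w = 0 := by
  obtain ⟨n, rfl⟩ := Complex.exp_eq_one_iff.1 h
  by_cases hn : n = 0
  · simp [hn]
  have h1 : (1 : ℝ) ≤ |(n : ℝ)| := by exact_mod_cast Int.one_le_abs hn
  have h2 : ‖((n : ℂ) * (2 * Real.pi * Complex.I))‖ = |(n : ℝ)| * (2 * Real.pi) := by
    simp [abs_of_pos Real.pi_pos]
  nlinarith [Real.pi_gt_three]

open Classical in
/-- The variation of a continuous logarithm of `f` along `[x, y]`. -/
noncomputable def logVar (f : ℝ → ℂ) (x y : ℝ) : ℂ :=
  if h : ∃ l : ℝ → ℂ, ContinuousOn l (Set.Icc x y) ∧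
      ∀ r ∈ Set.Icc x y, Complex.exp (l r) = f r
  then h.choose y - h.choose x else 0

theorem logVar_eq {f l : ℝ → ℂ} {x y : ℝ} (hxy : x ≤ y) (hl : ContinuousOn l (Set.Icc x y))
    (he : ∀ r ∈ Set.Icc x y, Complex.exp (l r) = f r) : logVar f x y = l y - l x := by
  have h : ∃ l : ℝ → ℂ, ContinuousOn l (Set.Icc x y) ∧
      ∀ r ∈ Set.Icc x y, Complex.exp (l r) = f r := ⟨l, hl, he⟩
  rw [logVar, dif_pos h]
  have := (isPreconnected_Icc (a := x) (b := y)).eq_of_exp_eq_one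
    (f := fun r => h.choose r - l r) (h.choose_spec.1.sub hl) (fun r hr => by
      rw [Complex.exp_sub, h.choose_spec.2 r hr, he r hr, div_self]
      rw [← he r hr]; exact Complex.exp_ne_zero _)
    (Set.left_mem_Icc.2 hxy) (Set.right_mem_Icc.2 hxy)
  linear_combination -this

theorem exp_logVar {f : ℝ → ℂ} {x y : ℝ} (hxy : x ≤ y)
    (hf : ContinuousOn f (Set.Icc x y)) (h0 : ∀ r ∈ Set.Icc x y, f r ≠ 0) :
    Complex.exp (logVar f x y) = f y / f x := by
  obtain ⟨l, hl, he⟩ := exists_continuousOn_log_Icc hxy hf h0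
  rw [logVar_eq hxy hl he, Complex.exp_sub, he _ (Set.left_mem_Icc.2 hxy),
    he _ (Set.right_mem_Icc.2 hxy)]

theorem div_mem_slitPlane {a b : ℂ} (h : ‖a - b‖ < ‖b‖) : a / b ∈ Complex.slitPlane := by
  have hb : b ≠ 0 := fun hb => by simp [hb] at h; exact absurd h (not_lt.2 (norm_nonneg _))
  have h1 : ‖a / b - 1‖ < 1 := by
    rw [div_sub_one hb, norm_div, div_lt_one (norm_pos_iff.2 hb)]
    exact h
  simpa using Complex.mem_slitPlane_of_norm_lt_one h1

theorem logVar_sub_logVar {f g : ℝ → ℂ} {x y : ℝ} (hxy : x ≤ y)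
    (hf : ContinuousOn f (Set.Icc x y)) (hg : ContinuousOn g (Set.Icc x y))
    (h : ∀ r ∈ Set.Icc x y, ‖f r - g r‖ < ‖g r‖) :
    logVar f x y - logVar g x y = Complex.log (f y / g y) - Complex.log (f x / g x) := by
  have hg0 : ∀ r ∈ Set.Icc x y, g r ≠ 0 := fun r hr h0 => by
    have := h r hr
    rw [h0, norm_zero] at this
    exact absurd this (not_lt.2 (norm_nonneg _))
  obtain ⟨l, hl, he⟩ := exists_continuousOn_log_Icc hxy hg hg0
  have hs : ∀ r ∈ Set.Icc x y, f r / g r ∈ Complex.slitPlane :=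
    fun r hr => div_mem_slitPlane (h r hr)
  rw [logVar_eq hxy hl he, logVar_eq (l := fun r => l r + Complex.log (f r / g r)) hxy
    (hl.add ((hf.div hg hg0).clog hs)) (fun r hr => by
      rw [Complex.exp_add, he r hr, Complex.exp_log (Complex.slitPlane_ne_zero (hs r hr)),
        mul_div_cancel₀ _ (hg0 r hr)])]
  ring

theorem norm_log_div_le {a b : ℂ} {m : ℝ} (hm : 0 < m) (hb : m ≤ ‖b‖) (h : ‖a - b‖ ≤ m / 2) :
    ‖Complex.log (a / b)‖ ≤ 3 / 2 * (‖a - b‖ / m) := by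
  have hb' : 0 < ‖b‖ := hm.trans_le hb
  have h1 : a / b = 1 + (a - b) / b := by
    field_simp [norm_pos_iff.1 hb']; ring
  have h3 : ‖(a - b) / b‖ ≤ ‖a - b‖ / m := by
    rw [norm_div]; gcongr
  have h2 : ‖(a - b) / b‖ ≤ 1 / 2 := h3.trans (by rw [div_le_div_iff₀ hm (by norm_num)]; linarith)
  rw [h1]
  exact (Complex.norm_log_one_add_half_le_self h2).trans (by gcongr)

/-- Small relative perturbations of `f` change the variation of its logarithm only slightly. -/
theorem norm_logVar_sub_logVar_le {f g : ℝ → ℂ} {x y m δ : ℝ} (hxy : x ≤ y) (hm : 0 < m)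
    (hδ : δ ≤ m / 2)
    (hf : ContinuousOn f (Set.Icc x y)) (hg : ContinuousOn g (Set.Icc x y))
    (hgm : ∀ r ∈ Set.Icc x y, m ≤ ‖g r‖)
    (h : ∀ r ∈ Set.Icc x y, ‖f r - g r‖ ≤ δ) :
    ‖logVar f x y - logVar g x y‖ ≤ 3 * (δ / m) := by
  rw [logVar_sub_logVar hxy hf hg (fun r hr => by
    have h1 := h r hr
    have h2 := hgm r hr
    linarith)]
  have key : ∀ r ∈ Set.Icc x y, ‖Complex.log (f r / g r)‖ ≤ 3 / 2 * (δ / m) := fun r hr =>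
    (norm_log_div_le hm (hgm r hr) ((h r hr).trans hδ)).trans (by
      have := h r hr
      gcongr)
  have h1 := key x (Set.left_mem_Icc.2 hxy)
  have h2 := key y (Set.right_mem_Icc.2 hxy)
  exact (norm_sub_le _ _).trans (by linarith)

theorem logVar_const {c : ℂ} {x y : ℝ} (hxy : x ≤ y) (hc : c ≠ 0) :
    logVar (fun _ => c) x y = 0 := by
  rw [logVar_eq (l := fun _ => Complex.log c) hxy continuousOn_const
    (fun r _ => Complex.exp_log hc), sub_self]

theorem logVar_comp_add (f : ℝ → ℂ) {x y : ℝ} (t : ℝ) (hxy : x ≤ y)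
    (hf : ContinuousOn f (Set.Icc (x + t) (y + t))) (h0 : ∀ r ∈ Set.Icc (x + t) (y + t), f r ≠ 0) :
    logVar (fun r => f (r + t)) x y = logVar f (x + t) (y + t) := by
  obtain ⟨l, hl, he⟩ := exists_continuousOn_log_Icc (by linarith) hf h0
  have hm : ∀ r ∈ Set.Icc x y, r + t ∈ Set.Icc (x + t) (y + t) := fun r hr =>
    ⟨by linarith [hr.1], by linarith [hr.2]⟩
  rw [logVar_eq (by linarith) hl he, logVar_eq (l := fun r => l (r + t)) hxy
    (hl.comp (by fun_prop) hm) (fun r hr => he _ (hm r hr))]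

theorem circle_winding_eq_zero {h : ℂ → ℂ} (hh : Continuous h) {p : ℂ} {r : ℝ} (hr : 0 < r)
    {b : ℤ} (he : ∀ θ : ℝ, Complex.exp (h (p + r * Complex.exp (θ * Complex.I))) =
      (r * Complex.exp (θ * Complex.I)) ^ b) : b = 0 := by
  have hr' : (r : ℂ) ≠ 0 := by exact_mod_cast hr.ne'
  have := (isPreconnected_univ (α := ℝ)).eq_of_exp_eq_one
    (f := fun θ : ℝ => h (p + r * Complex.exp (θ * Complex.I)) - b * (θ * Complex.I)
      - b * Real.log r)
    (by fun_prop) (fun θ _ => by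
      rw [Complex.exp_sub, Complex.exp_sub, he, mul_zpow, Complex.exp_int_mul,
        Complex.exp_int_mul, Complex.ofReal_log hr.le, Complex.exp_log hr']
      field_simp [Complex.exp_ne_zero]) (x := 0) (y := 2 * Real.pi) trivial trivial
  have e2 : Complex.exp (((2 * Real.pi : ℝ) : ℂ) * Complex.I) = 1 := by
    push_cast; exact Complex.exp_two_pi_mul_I
  simp only [e2, Complex.ofReal_zero, zero_mul, Complex.exp_zero, mul_zero] at this
  have h2 : (b : ℂ) * (((2 * Real.pi : ℝ) : ℂ) * Complex.I) = 0 := by linear_combination this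
  have h3 : (((2 * Real.pi : ℝ) : ℂ)) ≠ 0 := by
    exact_mod_cast (by positivity : (2 * Real.pi) ≠ 0)
  simpa [h3, Complex.I_ne_zero] using h2

/-- If a winding-number-like function `N` takes the values `a ≠ 0` at `p` and `b ≠ a` at `q`, and
`(z - p) ^ b / (z - q) ^ a` has a continuous logarithm on `R`, then `b = 0`. -/
theorem winding_eq_zero_of_log {R : Set ℂ} (hR : IsClosed R) {N : ℂ → ℤ}
    (hloc : ∀ z ∉ R, ∀ᶠ w in 𝓝 z, N w = N z) {C : ℝ}
    (hb : ∀ z ∉ R, C ≤ ‖z‖ → N z = 0) {p q : ℂ} (hp : p ∉ R) (hq : q ∉ R)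
    (ha : N p ≠ 0) (hab : N q ≠ N p)
    {l : ℂ → ℂ} (hl : ContinuousOn l R)
    (he : ∀ z ∈ R, Complex.exp (l z) * (z - q) ^ N p = (z - p) ^ N q) : N q = 0 := by
  classical
  set a := N p with ha'
  set b := N q with hb'
  obtain ⟨L, hL⟩ := ContinuousMap.exists_restrict_eq (Y := ℂ) hR ⟨R.domRestrict l, hl.domRestrict⟩
  have hLl : ∀ z ∈ R, L z = l z := fun z hz => DFunLike.congr_fun hL ⟨z, hz⟩
  set P : Set ℂ := {z | z ∉ R ∧ N z = a} with hP
  have hPo : IsOpen P := by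
    rw [isOpen_iff_mem_nhds]
    rintro z ⟨hz, hz'⟩
    filter_upwards [hloc z hz, hR.isOpen_compl.mem_nhds hz] with w h1 h2
    exact ⟨h2, h1.trans hz'⟩
  have hcl : closure P ⊆ P ∪ R := by
    intro z hz
    by_cases hzR : z ∈ R
    · exact Or.inr hzR
    obtain ⟨w, hw1, hw2⟩ := mem_closure_iff_nhds.1 hz _ (hloc z hzR)
    exact Or.inl ⟨hzR, hw1.symm.trans hw2.2⟩
  have hqc : q ∉ closure P := fun h => by
    rcases hcl h with h | h
    · exact hab h.2
    · exact hq h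
  have hpc : p ∉ closure Pᶜ := fun h => by
    rw [hPo.isClosed_compl.closure_eq] at h
    exact h ⟨hp, rfl⟩
  set H : ℂ → ℂ := fun z => if z ∈ P then Complex.exp (L z) * (z - q) ^ a else (z - p) ^ b with hH
  have hHc : Continuous H := by
    rw [← continuousOn_univ]
    refine ContinuousOn.if ?_ ?_ ?_
    · rintro z ⟨-, hz⟩
      have hz' : z ∈ closure P \ interior P := hz
      rw [hPo.interior_eq] at hz'
      have hzR : z ∈ R := (hcl hz'.1).resolve_left hz'.2
      rw [hLl z hzR, he z hzR]
    · refine (Complex.continuous_exp.comp L.continuous).continuousOn.mul ?_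
      refine ContinuousOn.zpow₀ (by fun_prop) _ (fun z hz => Or.inl ?_)
      rw [sub_ne_zero]
      rintro rfl
      exact hqc hz.2
    · refine ContinuousOn.zpow₀ (by fun_prop) _ (fun z hz => Or.inl ?_)
      rw [sub_ne_zero]
      rintro rfl
      exact hpc hz.2
  have hH0 : ∀ z, H z ≠ 0 := by
    intro z
    simp only [hH]
    split_ifs with h
    · refine mul_ne_zero (Complex.exp_ne_zero _) (zpow_ne_zero _ (sub_ne_zero.2 ?_))
      rintro rfl
      exact hqc (subset_closure h)
    · refine zpow_ne_zero _ (sub_ne_zero.2 ?_)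
      rintro rfl
      exact hpc (subset_closure h)
  obtain ⟨h, hh, hhe⟩ := exists_continuous_log hHc hH0
  set r : ℝ := |C| + 1 + ‖p‖ with hr
  have hr0 : 0 < r := by positivity
  refine circle_winding_eq_zero hh (p := p) hr0 (fun θ => ?_)
  set z := p + r * Complex.exp (θ * Complex.I) with hz
  have hzn : C < ‖z‖ := by
    have h1 : ‖(r : ℂ) * Complex.exp (θ * Complex.I)‖ = r := by
      rw [norm_mul, Complex.norm_exp_ofReal_mul_I]; simp [abs_of_pos hr0]
    have h2 : ‖(r : ℂ) * Complex.exp (θ * Complex.I)‖ ≤ ‖z‖ + ‖p‖ := by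
      have : (r : ℂ) * Complex.exp (θ * Complex.I) = z - p := by rw [hz]; ring
      rw [this]; exact norm_sub_le _ _
    have := le_abs_self C
    linarith
  have hzP : z ∉ P := fun hzP => ha (hzP.2.symm.trans (hb z hzP.1 hzn.le))
  rw [hhe]
  simp only [hH, if_neg hzP]
  rw [hz]; ring_nf

theorem segment_div_mem_slitPlane {P Q z : ℂ} (hz : z ∉ segment ℝ P Q) :
    (Q - z) / (P - z) ∈ Complex.slitPlane := by
  have hP : P - z ≠ 0 := fun h => hz (by
    rw [← sub_eq_zero.1 h]; exact left_mem_segment ℝ P Q)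
  by_contra h
  rw [Complex.mem_slitPlane_iff, not_or, not_lt, not_not] at h
  obtain ⟨h1, h2⟩ := h
  set c : ℝ := -((Q - z) / (P - z)).re with hc
  have hc0 : 0 ≤ c := by linarith
  have h3 : (Q - z) / (P - z) = -(c : ℂ) := by
    apply Complex.ext <;> simp [hc, h2]
  rw [div_eq_iff hP] at h3
  apply hz
  have h4 : (1 + (c : ℂ)) ≠ 0 := by
    have : (1 + c) ≠ 0 := by positivity
    exact_mod_cast this
  refine ⟨c / (1 + c), 1 / (1 + c), by positivity, by positivity, by field_simp; ring, ?_⟩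
  simp only [Complex.real_smul]
  push_cast
  field_simp
  linear_combination h3

/-- The logarithmic variation of `w - z` as `w` runs along the segment from `P` to `Q`. -/
noncomputable def segLog (P Q z : ℂ) : ℂ := Complex.log ((Q - z) / (P - z))

theorem exp_segLog {P Q z : ℂ} (hz : z ∉ segment ℝ P Q) :
    Complex.exp (segLog P Q z) = (Q - z) / (P - z) :=
  Complex.exp_log (Complex.slitPlane_ne_zero (segment_div_mem_slitPlane hz))

theorem sub_ne_zero_of_notMem_segment_left {P Q z : ℂ} (hz : z ∉ segment ℝ P Q) : P - z ≠ 0 :=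
  fun h => hz (by rw [← sub_eq_zero.1 h]; exact left_mem_segment ℝ P Q)

theorem sub_ne_zero_of_notMem_segment_right {P Q z : ℂ} (hz : z ∉ segment ℝ P Q) : Q - z ≠ 0 :=
  fun h => hz (by rw [← sub_eq_zero.1 h]; exact right_mem_segment ℝ P Q)

theorem continuousAt_segLog {P Q z : ℂ} (hz : z ∉ segment ℝ P Q) :
    ContinuousAt (segLog P Q) z := by
  have := sub_ne_zero_of_notMem_segment_left hz
  exact ContinuousAt.clog (by fun_prop (disch := assumption)) (segment_div_mem_slitPlane hz)

theorem continuousOn_segLog_right {P Q z : ℂ} (hz : z ∉ segment ℝ P Q) :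
    ContinuousOn (fun w => segLog P w z) (segment ℝ P Q) := by
  refine ContinuousOn.clog (by fun_prop) (fun w hw => segment_div_mem_slitPlane fun h => hz ?_)
  exact (convex_segment P Q).segment_subset (left_mem_segment ℝ P Q) hw h

@[simp] theorem segLog_self {P z : ℂ} : segLog P P z = 0 := by
  unfold segLog
  by_cases h : P - z = 0
  · simp [h]
  · rw [div_self h, Complex.log_one]

theorem exists_pos_le_norm_sub {f : ℝ → ℂ} {x y : ℝ} (hf : ContinuousOn f (Set.Icc x y)) {z : ℂ}
    (hz : z ∉ f '' Set.Icc x y) : ∃ m > 0, ∀ r ∈ Set.Icc x y, m ≤ ‖f r - z‖ := by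
  have hc : IsClosed (f '' Set.Icc x y) := (isCompact_Icc.image_of_continuousOn hf).isClosed
  obtain ⟨m, hm, hb⟩ := Metric.isOpen_iff.1 hc.isOpen_compl z hz
  refine ⟨m, hm, fun r hr => ?_⟩
  by_contra h
  push Not at h
  exact hb (by simpa [dist_eq_norm] using h) ⟨r, hr, rfl⟩

theorem continuousAt_logVar_sub {f : ℝ → ℂ} {x y : ℝ} (hxy : x ≤ y)
    (hf : ContinuousOn f (Set.Icc x y)) {z : ℂ} (hz : z ∉ f '' Set.Icc x y) :
    ContinuousAt (fun z => logVar (fun r => f r - z) x y) z := by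
  obtain ⟨m, hm, hb⟩ := exists_pos_le_norm_sub hf hz
  rw [Metric.continuousAt_iff]
  intro ε hε
  refine ⟨min (m / 2) (ε * m / 6), by positivity, fun {w} hw => ?_⟩
  rw [dist_eq_norm] at hw ⊢
  have h := norm_logVar_sub_logVar_le (f := fun r => f r - w) (g := fun r => f r - z)
    (δ := ‖w - z‖) hxy hm (hw.le.trans (min_le_left _ _)) (by fun_prop) (by fun_prop) hb
    (fun r _ => by rw [sub_sub_sub_cancel_left, norm_sub_rev])
  have h2 : ‖w - z‖ < ε * m / 6 := hw.trans_le (min_le_right _ _)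
  calc _ ≤ _ := h
    _ ≤ 3 * ((ε * m / 6) / m) := by gcongr
    _ = ε / 2 := by field_simp; norm_num
    _ < ε := by linarith

/-- Functions on two disjoint injective arcs and on two closed sets meeting them only at their
endpoints can be glued. -/
theorem exists_continuousOn_glue {φ : ℝ → ℂ} {s₀ s₁ t₀ t₁ : ℝ} (hs : s₀ ≤ s₁) (hst : s₁ < t₀)
    (ht : t₀ ≤ t₁) (hφ : Continuous φ) (hinj : Set.InjOn φ (Set.Icc s₀ t₁))
    {K₀ K₁ : Set ℂ} (hK₀ : IsClosed K₀) (hK₁ : IsClosed K₁) (hK : Disjoint K₀ K₁)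
    (h₀s : ∀ r ∈ Set.Icc s₀ s₁, φ r ∈ K₀ → r = s₀) (h₁s : ∀ r ∈ Set.Icc s₀ s₁, φ r ∈ K₁ → r = s₁)
    (h₀t : ∀ r ∈ Set.Icc t₀ t₁, φ r ∈ K₀ → r = t₀) (h₁t : ∀ r ∈ Set.Icc t₀ t₁, φ r ∈ K₁ → r = t₁)
    {f g : ℝ → ℂ} {k₀ k₁ : ℂ → ℂ} (hf : ContinuousOn f (Set.Icc s₀ s₁))
    (hg : ContinuousOn g (Set.Icc t₀ t₁)) (hk₀ : ContinuousOn k₀ K₀) (hk₁ : ContinuousOn k₁ K₁)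
    (e₀s : k₀ (φ s₀) = f s₀) (e₁s : k₁ (φ s₁) = f s₁) (e₀t : k₀ (φ t₀) = g t₀)
    (e₁t : k₁ (φ t₁) = g t₁) :
    ∃ G : ℂ → ℂ, ContinuousOn G (φ '' Set.Icc s₀ s₁ ∪ φ '' Set.Icc t₀ t₁ ∪ K₀ ∪ K₁) ∧
      (∀ r ∈ Set.Icc s₀ s₁, G (φ r) = f r) ∧ (∀ r ∈ Set.Icc t₀ t₁, G (φ r) = g r) ∧
      (∀ z ∈ K₀, G z = k₀ z) ∧ (∀ z ∈ K₁, G z = k₁ z) := by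
  classical
  have sub1 : Set.Icc s₀ s₁ ⊆ Set.Icc s₀ t₁ := Set.Icc_subset_Icc_right (by linarith)
  have sub2 : Set.Icc t₀ t₁ ⊆ Set.Icc s₀ t₁ := Set.Icc_subset_Icc_left (by linarith)
  have desc : ∀ {a b : ℝ} {h : ℝ → ℂ} {G : ℂ → ℂ}, Set.Icc a b ⊆ Set.Icc s₀ t₁ →
      ContinuousOn h (Set.Icc a b) → (∀ r ∈ Set.Icc a b, G (φ r) = h r) →
      ContinuousOn G (φ '' Set.Icc a b) := by
    intro a b h G hsub hh hG
    have hq : IsClosedEmbedding (fun r : Set.Icc a b => φ r) :=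
      (hφ.comp continuous_subtype_val).isClosedEmbedding
        (fun r r' hrr => Subtype.ext (hinj (hsub r.2) (hsub r'.2) hrr))
    have hr : Set.range (fun r : Set.Icc a b => φ r) = φ '' Set.Icc a b := by
      rw [Set.image_eq_range]
    rw [continuousOn_iff_isClosed]
    intro T hT
    obtain ⟨T', hT', hTT⟩ := (continuousOn_iff_isClosed.1 hh) T hT
    refine ⟨φ '' (T' ∩ Set.Icc a b), ?_, ?_⟩
    · exact ((isCompact_Icc.inter_left hT').image hφ).isClosed
    · ext z
      constructor
      · rintro ⟨hz, r, hr, rfl⟩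
        have : r ∈ h ⁻¹' T ∩ Set.Icc a b := ⟨by simpa [hG r hr] using hz, hr⟩
        rw [hTT] at this
        exact ⟨⟨r, this, rfl⟩, ⟨r, hr, rfl⟩⟩
      · rintro ⟨⟨r, hr, rfl⟩, -⟩
        have h3 : r ∈ h ⁻¹' T ∩ Set.Icc a b := by rw [hTT]; exact hr
        exact ⟨by simpa [hG r hr.2] using h3.1, ⟨r, hr.2, rfl⟩⟩
  set i : ℂ → ℝ := Function.invFunOn φ (Set.Icc s₀ t₁) with hi
  have hiφ : ∀ r ∈ Set.Icc s₀ t₁, i (φ r) = r := fun r hr => hinj.leftInvOn_invFunOn hr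
  set G : ℂ → ℂ := fun z => if z ∈ K₀ then k₀ z else if z ∈ K₁ then k₁ z else
    if i z ≤ s₁ then f (i z) else g (i z) with hGdef
  have G0 : ∀ z ∈ K₀, G z = k₀ z := fun z hz => by simp only [hGdef, if_pos hz]
  have G1 : ∀ z ∈ K₁, G z = k₁ z := fun z hz => by
    simp only [hGdef, if_pos hz, if_neg (fun h => Set.disjoint_left.1 hK h hz : z ∉ K₀)]
  have GA : ∀ r ∈ Set.Icc s₀ s₁, G (φ r) = f r := by
    intro r hr
    by_cases h0 : φ r ∈ K₀
    · rw [G0 _ h0, h₀s r hr h0, e₀s]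
    by_cases h1 : φ r ∈ K₁
    · rw [G1 _ h1, h₁s r hr h1, e₁s]
    simp only [hGdef, if_neg h0, if_neg h1, hiφ r (sub1 hr), if_pos hr.2]
  have GB : ∀ r ∈ Set.Icc t₀ t₁, G (φ r) = g r := by
    intro r hr
    by_cases h0 : φ r ∈ K₀
    · rw [G0 _ h0, h₀t r hr h0, e₀t]
    by_cases h1 : φ r ∈ K₁
    · rw [G1 _ h1, h₁t r hr h1, e₁t]
    simp only [hGdef, if_neg h0, if_neg h1, hiφ r (sub2 hr),
      if_neg (not_le.2 (hst.trans_le hr.1))]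
  have cA : IsClosed (φ '' Set.Icc s₀ s₁) := (isCompact_Icc.image hφ).isClosed
  have cB : IsClosed (φ '' Set.Icc t₀ t₁) := (isCompact_Icc.image hφ).isClosed
  refine ⟨G, ?_, GA, GB, G0, G1⟩
  refine ContinuousOn.union_of_isClosed (ContinuousOn.union_of_isClosed
    (ContinuousOn.union_of_isClosed (desc sub1 hf GA) (desc sub2 hg GB) cA cB)
      (hk₀.congr G0) (cA.union cB) hK₀) (hk₁.congr G1) ((cA.union cB).union hK₀) hK₁

/-- Two disjoint arcs of an injective curve, joined at their endpoints by disjoint segments meeting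
the arcs nowhere else. -/
structure IsLadder (φ : ℝ → ℂ) (s₀ s₁ t₀ t₁ : ℝ) : Prop where
  cont : Continuous φ
  inj : Set.InjOn φ (Set.Ici 0)
  nonneg : 0 ≤ s₀
  lt_s : s₀ < s₁
  lt_st : s₁ < t₀
  lt_t : t₀ < t₁
  disj : Disjoint (segment ℝ (φ s₀) (φ t₀)) (segment ℝ (φ s₁) (φ t₁))
  h₀s : ∀ r ∈ Set.Icc s₀ s₁, φ r ∈ segment ℝ (φ s₀) (φ t₀) → r = s₀
  h₁s : ∀ r ∈ Set.Icc s₀ s₁, φ r ∈ segment ℝ (φ s₁) (φ t₁) → r = s₁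
  h₀t : ∀ r ∈ Set.Icc t₀ t₁, φ r ∈ segment ℝ (φ s₀) (φ t₀) → r = t₀
  h₁t : ∀ r ∈ Set.Icc t₀ t₁, φ r ∈ segment ℝ (φ s₁) (φ t₁) → r = t₁

/-- The closed curve formed by the arcs and segments of a ladder. -/
def ladderRim (φ : ℝ → ℂ) (s₀ s₁ t₀ t₁ : ℝ) : Set ℂ :=
  φ '' Set.Icc s₀ s₁ ∪ φ '' Set.Icc t₀ t₁ ∪ segment ℝ (φ s₀) (φ t₀) ∪ segment ℝ (φ s₁) (φ t₁)

/-- `2πi` times the winding number of the rim of a ladder around `z`. -/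
noncomputable def ladderVar (φ : ℝ → ℂ) (s₀ s₁ t₀ t₁ : ℝ) (z : ℂ) : ℂ :=
  logVar (fun r => φ r - z) s₀ s₁ - logVar (fun r => φ r - z) t₀ t₁
    - segLog (φ s₀) (φ t₀) z + segLog (φ s₁) (φ t₁) z

namespace IsLadder

variable {φ : ℝ → ℂ} {s₀ s₁ t₀ t₁ : ℝ}

theorem notMem_rim_iff {z : ℂ} : z ∉ ladderRim φ s₀ s₁ t₀ t₁ ↔
    z ∉ φ '' Set.Icc s₀ s₁ ∧ z ∉ φ '' Set.Icc t₀ t₁ ∧ z ∉ segment ℝ (φ s₀) (φ t₀) ∧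
      z ∉ segment ℝ (φ s₁) (φ t₁) := by
  simp only [ladderRim, Set.mem_union, not_or, and_assoc]

theorem _root_.isClosed_segment_complex (P Q : ℂ) : IsClosed (segment ℝ P Q) := by
  rw [segment_eq_image_lineMap]
  exact (isCompact_Icc.image (by fun_prop)).isClosed

theorem isClosed_rim (h : IsLadder φ s₀ s₁ t₀ t₁) : IsClosed (ladderRim φ s₀ s₁ t₀ t₁) :=
  (((isCompact_Icc.image h.cont).isClosed.union (isCompact_Icc.image h.cont).isClosed).union
    (isClosed_segment_complex _ _)).union (isClosed_segment_complex _ _)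

theorem sub_ne_zero_of_notMem {f : ℝ → ℂ} {I : Set ℝ} {z : ℂ} (hz : z ∉ f '' I) :
    ∀ r ∈ I, f r - z ≠ 0 := fun r hr h0 => hz ⟨r, hr, sub_eq_zero.1 h0⟩

theorem exp_var (h : IsLadder φ s₀ s₁ t₀ t₁) {z : ℂ} (hz : z ∉ ladderRim φ s₀ s₁ t₀ t₁) :
    Complex.exp (ladderVar φ s₀ s₁ t₀ t₁ z) = 1 := by
  obtain ⟨z1, z2, z3, z4⟩ := notMem_rim_iff.1 hz
  have hc : Continuous fun r => φ r - z := h.cont.sub continuous_const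
  rw [ladderVar, Complex.exp_add, Complex.exp_sub, Complex.exp_sub,
    exp_logVar h.lt_s.le hc.continuousOn (sub_ne_zero_of_notMem z1),
    exp_logVar h.lt_t.le hc.continuousOn (sub_ne_zero_of_notMem z2), exp_segLog z3, exp_segLog z4]
  have e1 := sub_ne_zero_of_notMem_segment_left z3
  have e2 := sub_ne_zero_of_notMem_segment_left z4
  have e3 := sub_ne_zero_of_notMem_segment_right z3
  have e4 := sub_ne_zero_of_notMem_segment_right z4
  field_simp

theorem continuousAt_var (h : IsLadder φ s₀ s₁ t₀ t₁) {z : ℂ}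
    (hz : z ∉ ladderRim φ s₀ s₁ t₀ t₁) : ContinuousAt (ladderVar φ s₀ s₁ t₀ t₁) z := by
  obtain ⟨z1, z2, z3, z4⟩ := notMem_rim_iff.1 hz
  exact (((continuousAt_logVar_sub h.lt_s.le h.cont.continuousOn z1).sub
    (continuousAt_logVar_sub h.lt_t.le h.cont.continuousOn z2)).sub
      (continuousAt_segLog z3)).add (continuousAt_segLog z4)

/-- One of the four matched logarithms on the pieces of the rim; the mismatch at `φ t₀` is the
total variation. -/
theorem exists_logs (h : IsLadder φ s₀ s₁ t₀ t₁) {z : ℂ}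
    (hz : z ∉ ladderRim φ s₀ s₁ t₀ t₁) :
    ∃ (f g : ℝ → ℂ) (k₀ k₁ : ℂ → ℂ), ContinuousOn f (Set.Icc s₀ s₁) ∧
      ContinuousOn g (Set.Icc t₀ t₁) ∧ ContinuousOn k₀ (segment ℝ (φ s₀) (φ t₀)) ∧
      ContinuousOn k₁ (segment ℝ (φ s₁) (φ t₁)) ∧
      (∀ r ∈ Set.Icc s₀ s₁, Complex.exp (f r) = φ r - z) ∧
      (∀ r ∈ Set.Icc t₀ t₁, Complex.exp (g r) = φ r - z) ∧
      (∀ w ∈ segment ℝ (φ s₀) (φ t₀), Complex.exp (k₀ w) = w - z) ∧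
      (∀ w ∈ segment ℝ (φ s₁) (φ t₁), Complex.exp (k₁ w) = w - z) ∧
      k₀ (φ s₀) = f s₀ ∧ k₁ (φ s₁) = f s₁ ∧ k₁ (φ t₁) = g t₁ ∧
      g t₀ - k₀ (φ t₀) = ladderVar φ s₀ s₁ t₀ t₁ z := by
  obtain ⟨z1, z2, z3, z4⟩ := notMem_rim_iff.1 hz
  have hc : Continuous fun r => φ r - z := h.cont.sub continuous_const
  have ms0 := Set.left_mem_Icc.2 h.lt_s.le
  have ms1 := Set.right_mem_Icc.2 h.lt_s.le
  have mt0 := Set.left_mem_Icc.2 h.lt_t.le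
  have mt1 := Set.right_mem_Icc.2 h.lt_t.le
  obtain ⟨a, ha, hae⟩ := exists_continuousOn_log_Icc h.lt_s.le hc.continuousOn
    (sub_ne_zero_of_notMem z1)
  obtain ⟨b, hb, hbe⟩ := exists_continuousOn_log_Icc h.lt_t.le hc.continuousOn
    (sub_ne_zero_of_notMem z2)
  have e1 := sub_ne_zero_of_notMem_segment_left z3
  have e2 := sub_ne_zero_of_notMem_segment_left z4
  have e4 := sub_ne_zero_of_notMem_segment_right z4
  have hsub : ∀ {P Q w : ℂ}, z ∉ segment ℝ P Q → w ∈ segment ℝ P Q → z ∉ segment ℝ P w :=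
    fun hz hw h' => hz ((convex_segment _ _).segment_subset (left_mem_segment ℝ _ _) hw h')
  refine ⟨a, fun r => b r - b t₁ + a s₁ + segLog (φ s₁) (φ t₁) z,
    fun w => a s₀ + segLog (φ s₀) w z, fun w => a s₁ + segLog (φ s₁) w z, ha, ?_, ?_, ?_, hae,
    ?_, ?_, ?_, ?_, ?_, ?_, ?_⟩
  · fun_prop
  · exact continuousOn_const.add (continuousOn_segLog_right z3)
  · exact continuousOn_const.add (continuousOn_segLog_right z4)
  · intro r hr
    rw [Complex.exp_add, Complex.exp_add, Complex.exp_sub, hbe r hr, hbe t₁ mt1, hae s₁ ms1,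
      exp_segLog z4]
    field_simp
  · intro w hw
    rw [Complex.exp_add, hae s₀ ms0, exp_segLog (hsub z3 hw)]
    field_simp
  · intro w hw
    rw [Complex.exp_add, hae s₁ ms1, exp_segLog (hsub z4 hw)]
    field_simp
  · simp
  · simp
  · simp
  · rw [ladderVar, logVar_eq h.lt_s.le ha hae, logVar_eq h.lt_t.le hb hbe]
    ring

/-- The winding number around the rim of a ladder takes at most one nonzero value. -/
theorem var_eq_of_ne_zero (h : IsLadder φ s₀ s₁ t₀ t₁) {C : ℝ}
    (hC : ∀ z ∉ ladderRim φ s₀ s₁ t₀ t₁, C ≤ ‖z‖ → ladderVar φ s₀ s₁ t₀ t₁ z = 0) {p q : ℂ}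
    (hp : p ∉ ladderRim φ s₀ s₁ t₀ t₁) (hq : q ∉ ladderRim φ s₀ s₁ t₀ t₁)
    (hp0 : ladderVar φ s₀ s₁ t₀ t₁ p ≠ 0) (hq0 : ladderVar φ s₀ s₁ t₀ t₁ q ≠ 0) :
    ladderVar φ s₀ s₁ t₀ t₁ q = ladderVar φ s₀ s₁ t₀ t₁ p := by
  classical
  have hint : ∀ z, ∃ n : ℤ, z ∉ ladderRim φ s₀ s₁ t₀ t₁ →
      ladderVar φ s₀ s₁ t₀ t₁ z = n * (2 * Real.pi * Complex.I) := by
    intro z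
    by_cases hz : z ∈ ladderRim φ s₀ s₁ t₀ t₁
    · exact ⟨0, fun h => absurd hz h⟩
    · obtain ⟨n, hn⟩ := Complex.exp_eq_one_iff.1 (h.exp_var hz)
      exact ⟨n, fun _ => hn⟩
  choose N hN using hint
  have h2 : (2 * Real.pi * Complex.I : ℂ) ≠ 0 := Complex.two_pi_I_ne_zero
  have hN0 : ∀ z ∉ ladderRim φ s₀ s₁ t₀ t₁, (N z = 0 ↔ ladderVar φ s₀ s₁ t₀ t₁ z = 0) := by
    intro z hz
    rw [hN z hz]
    simp [h2]
  by_contra hne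
  apply hq0
  rw [← hN0 q hq]
  obtain ⟨f, g, k₀, k₁, cf, cg, ck₀, ck₁, ef, eg, ek₀, ek₁, m1, m2, m3, m4⟩ := h.exists_logs hp
  obtain ⟨f', g', k₀', k₁', cf', cg', ck₀', ck₁', ef', eg', ek₀', ek₁', m1', m2', m3', m4'⟩ :=
    h.exists_logs hq
  obtain ⟨G, hG, Gs, Gt, G0, G1⟩ := exists_continuousOn_glue h.lt_s.le h.lt_st h.lt_t.le h.cont
    (h.inj.mono (fun r hr => h.nonneg.trans hr.1)) (isClosed_segment_complex _ _)
    (isClosed_segment_complex _ _) h.disj h.h₀s h.h₁s h.h₀t h.h₁t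
    (f := fun r => N q * f r - N p * f' r) (g := fun r => N q * g r - N p * g' r)
    (k₀ := fun r => N q * k₀ r - N p * k₀' r) (k₁ := fun r => N q * k₁ r - N p * k₁' r)
    (by fun_prop) (by fun_prop) (by fun_prop) (by fun_prop)
    (by simp only [m1, m1']) (by simp only [m2, m2'])
    (by
      rw [hN p hp] at m4
      rw [hN q hq] at m4'
      linear_combination -(N q : ℂ) * m4 + (N p : ℂ) * m4')
    (by simp only [m3, m3'])
  refine winding_eq_zero_of_log h.isClosed_rim (N := N) (C := C) ?_ ?_ hp hq ?_ ?_ hG ?_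
  · intro z hz
    have hev : ∀ᶠ w in 𝓝 z, ‖ladderVar φ s₀ s₁ t₀ t₁ w - ladderVar φ s₀ s₁ t₀ t₁ z‖ < 6 := by
      have := Metric.continuousAt_iff'.1 (h.continuousAt_var hz) 6 (by norm_num)
      simpa [dist_eq_norm] using this
    filter_upwards [hev, h.isClosed_rim.isOpen_compl.mem_nhds hz] with w hw1 hw2
    have := eq_zero_of_exp_eq_one_of_norm_lt (by
      rw [Complex.exp_sub, h.exp_var hw2, h.exp_var hz, div_one]) hw1
    rw [hN z hz, hN w hw2, ← sub_mul, mul_eq_zero, or_iff_left h2, sub_eq_zero] at this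
    exact_mod_cast this
  · intro z hz hzC
    exact (hN0 z hz).2 (hC z hz hzC)
  · rwa [Ne, hN0 p hp]
  · intro heq
    exact hne (by rw [hN p hp, hN q hq, heq])
  · have key : ∀ {u v w : ℂ}, Complex.exp u = w - p → Complex.exp v = w - q →
        Complex.exp (N q * u - N p * v) * (w - q) ^ N p = (w - p) ^ N q := by
      intro u v w hu hv
      rw [Complex.exp_sub, Complex.exp_int_mul, Complex.exp_int_mul, hu, hv, div_mul_cancel₀]
      apply zpow_ne_zero
      rw [← hv]; exact Complex.exp_ne_zero _
    rintro z (((⟨r, hr, rfl⟩ | ⟨r, hr, rfl⟩) | hz) | hz)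
    · rw [Gs r hr]; exact key (ef r hr) (ef' r hr)
    · rw [Gt r hr]; exact key (eg r hr) (eg' r hr)
    · rw [G0 z hz]; exact key (ek₀ z hz) (ek₀' z hz)
    · rw [G1 z hz]; exact key (ek₁ z hz) (ek₁' z hz)

end IsLadder

theorem alternation {E₀ E₁ : Set ℝ} (hE₀ : IsClosed E₀) (hE₁ : IsClosed E₁)
    (hE : Disjoint E₀ E₁) {W₀ W₁ : ℝ → ℝ} {x b : ℝ}
    (hW₀ : ∀ u v, x ≤ u → u ≤ v → v ≤ b → (∀ w ∈ Set.Icc u v, w ∉ E₀) → W₀ u = W₀ v)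
    (hW₁ : ∀ u v, x ≤ u → u ≤ v → v ≤ b → (∀ w ∈ Set.Icc u v, w ∉ E₁) → W₁ u = W₁ v)
    (h₁₀ : ∀ u v, x ≤ u → u < v → v ≤ b → u ∈ E₁ → v ∈ E₀ →
      (∀ w ∈ Set.Ioo u v, w ∉ E₀ ∧ w ∉ E₁) → ∃ w ∈ Set.Ioo u v, W₀ w = W₁ w)
    (h₀₁ : ∀ u v, x ≤ u → u < v → v ≤ b → u ∈ E₀ → v ∈ E₁ →
      (∀ w ∈ Set.Ioo u v, w ∉ E₀ ∧ w ∉ E₁) → ∃ w ∈ Set.Ioo u v, W₁ w ≤ W₀ w)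
    (hx : W₀ x = W₁ x ∨ ∃ v ∈ E₁, x ≤ v ∧ ∀ w ∈ Set.Ico x v, w ∉ E₀)
    (hxb : x ≤ b) (hb : W₀ b = W₁ b ∨ ∃ v ∈ E₀, x ≤ v ∧ v ≤ b ∧ ∀ w ∈ Set.Ioc v b, w ∉ E₁)
    (hx₀ : x ∉ E₀) (hx₁ : x ∉ E₁) (hb₀ : b ∉ E₀) (hb₁ : b ∉ E₁) :
    W₀ x ≤ W₁ b := by
  obtain ⟨δ, hδ, hsep⟩ : ∃ δ > 0, ∀ u ∈ E₀, ∀ v ∈ E₁, x ≤ u → u ≤ b → δ ≤ |u - v| := by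
    obtain ⟨r, hr, h⟩ := Metric.exists_pos_forall_lt_edist
      (isCompact_Icc.inter_right hE₀ : IsCompact (Set.Icc x b ∩ E₀)) hE₁
      (hE.mono_left Set.inter_subset_right)
    refine ⟨r, hr, fun u hu v hv h1 h2 => ?_⟩
    have := h u ⟨⟨h1, h2⟩, hu⟩ v hv
    rw [edist_nndist, ENNReal.coe_lt_coe] at this
    rw [← Real.dist_eq, ← coe_nndist]
    exact_mod_cast this.le
  have maxE : ∀ {E : Set ℝ} {y : ℝ}, IsClosed E → (∃ w ∈ E, x ≤ w ∧ w ≤ y) →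
      ∃ e ∈ E, x ≤ e ∧ e ≤ y ∧ ∀ w ∈ E, w ≤ y → w ≤ e := by
    rintro E y hEc ⟨w, hw, hw1, hw2⟩
    obtain ⟨e, he, hmax⟩ :=
      (isCompact_Icc.inter_right hEc : IsCompact (Set.Icc x y ∩ E)).exists_isGreatest
        ⟨w, ⟨hw1, hw2⟩, hw⟩
    refine ⟨e, he.2, he.1.1, he.1.2, fun w' hw' hy => ?_⟩
    by_cases hxw : x ≤ w'
    · exact hmax ⟨⟨hxw, hy⟩, hw'⟩
    · exact (not_le.1 hxw).le.trans he.1.1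
  have minE : ∀ {E : Set ℝ} {a y : ℝ}, IsClosed E → (∃ w ∈ E, a ≤ w ∧ w ≤ y) →
      ∃ e ∈ E, a ≤ e ∧ e ≤ y ∧ ∀ w ∈ E, a ≤ w → e ≤ w := by
    rintro E a y hEc ⟨w, hw, hw1, hw2⟩
    obtain ⟨e, he, hmin⟩ :=
      (isCompact_Icc.inter_right hEc : IsCompact (Set.Icc a y ∩ E)).exists_isLeast
        ⟨w, ⟨hw1, hw2⟩, hw⟩
    refine ⟨e, he.2, he.1.1, he.1.2, fun w' hw' hy => ?_⟩
    by_cases hxw : w' ≤ y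
    · exact hmin ⟨⟨hy, hxw⟩, hw'⟩
    · exact he.1.2.trans (not_le.1 hxw).le
  have main : ∀ n : ℕ, ∀ y, x ≤ y → y ≤ b → y - x ≤ n * (δ / 2) → y ∉ E₀ → y ∉ E₁ →
      (W₀ y = W₁ y ∨ ∃ v ∈ E₀, x ≤ v ∧ v ≤ y ∧ ∀ w ∈ Set.Ioc v y, w ∉ E₁) → W₀ x ≤ W₁ y := by
    intro n
    induction n with
    | zero =>
      intro y hxy hyb hn hy0 hy1 hy
      obtain rfl : y = x := by push_cast at hn; linarith
      rcases hy with hy | ⟨v, hv, h1, h2, -⟩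
      · exact hy.le
      · exact absurd (le_antisymm h2 h1 ▸ hv) hy0
    | succ n ih =>
      intro y hxy hyb hn hy0 hy1 hy
      push_cast at hn
      by_cases hn0 : ∃ w ∈ E₀, x ≤ w ∧ w ≤ y
      swap
      · push Not at hn0
        rcases hy with hy | ⟨v, hv, h1, h2, -⟩
        · rw [hW₀ x y le_rfl hxy hyb (fun w hw hw0 => not_lt.2 hw.2 (hn0 w hw0 hw.1)), hy]
        · exact absurd h2 (not_le.2 (hn0 v hv h1))
      by_cases hn1 : ∃ w ∈ E₁, x ≤ w ∧ w ≤ y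
      swap
      · push Not at hn1
        rcases hx with hx | ⟨v, hv, hxv, h1⟩
        · rw [hx, hW₁ x y le_rfl hxy hyb (fun w hw hw0 => not_lt.2 hw.2 (hn1 w hw0 hw.1))]
        · obtain ⟨w, hw, hw1, hw2⟩ := hn0
          have hwv : v ≤ w := by
            by_contra hlt
            exact h1 w ⟨hw1, not_le.1 hlt⟩ hw
          exact absurd (hwv.trans hw2) (not_le.2 (hn1 v hv hxv))
      obtain ⟨e0, he0, hxe0, he0y, hmax0⟩ := maxE hE₀ hn0
      obtain ⟨e1, he1, hxe1, he1y, hmax1⟩ := maxE hE₁ hn1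
      have he0y' : e0 < y := lt_of_le_of_ne he0y (fun h => hy0 (h ▸ he0))
      have he1y' : e1 < y := lt_of_le_of_ne he1y (fun h => hy1 (h ▸ he1))
      rcases lt_trichotomy e1 e0 with hlt | heq | hlt
      · obtain ⟨g, hg, hg1, hg2, hgmin⟩ := minE hE₀ ⟨e0, he0, hlt.le, he0y⟩
        have hlt' : e1 < g := lt_of_le_of_ne hg1 (fun h => Set.disjoint_left.1 hE hg (h ▸ he1))
        have gap : ∀ w ∈ Set.Ioo e1 g, w ∉ E₀ ∧ w ∉ E₁ := fun w hw =>
          ⟨fun h => not_le.2 hw.2 (hgmin w h hw.1.le),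
            fun h => not_le.2 hw.1 (hmax1 w h (hw.2.le.trans hg2))⟩
        obtain ⟨w, hw, hwD⟩ := h₁₀ e1 g hxe1 hlt' (hg2.trans hyb) he1 hg gap
        have hs := hsep g hg e1 he1 (hxe1.trans hg1) (hg2.trans hyb)
        rw [abs_of_pos (by linarith)] at hs
        set m := (e1 + g) / 2 with hm
        have hmI : m ∈ Set.Ioo e1 g := ⟨by linarith, by linarith⟩
        have eqI : ∀ u ∈ Set.Ioo e1 g, ∀ v ∈ Set.Ioo e1 g, u ≤ v → W₀ u = W₀ v ∧ W₁ u = W₁ v :=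
          fun u hu v hv huv =>
            ⟨hW₀ u v (hxe1.trans hu.1.le) huv (hv.2.le.trans (hg2.trans hyb))
              (fun w hw => (gap w ⟨hu.1.trans_le hw.1, hw.2.trans_lt hv.2⟩).1),
            hW₁ u v (hxe1.trans hu.1.le) huv (hv.2.le.trans (hg2.trans hyb))
              (fun w hw => (gap w ⟨hu.1.trans_le hw.1, hw.2.trans_lt hv.2⟩).2)⟩
        have hmD : W₀ m = W₁ m := by
          rcases le_total m w with h | h
          · obtain ⟨h1, h2⟩ := eqI m hmI w hw h
            rw [h1, h2, hwD]
          · obtain ⟨h1, h2⟩ := eqI w hw m hmI h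
            rw [← h1, ← h2, hwD]
        have := ih m (hxe1.trans hmI.1.le) ((hmI.2.le.trans hg2).trans hyb) (by linarith)
          (gap m hmI).1 (gap m hmI).2 (Or.inl hmD)
        rwa [hW₁ m y (hxe1.trans hmI.1.le) (hmI.2.le.trans hg2) hyb (fun w hw h =>
          not_le.2 (hmI.1.trans_le hw.1) (hmax1 w h hw.2))] at this
      · exact absurd (heq ▸ he1) (Set.disjoint_left.1 hE he0)
      · have hyD : W₀ y = W₁ y := hy.resolve_right (by
          rintro ⟨v, hv, -, h2, h3⟩
          exact h3 e1 ⟨(hmax0 v hv h2).trans_lt hlt, he1y⟩ he1)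
        obtain ⟨g, hg, hg1, hg2, hgmin⟩ := minE hE₁ ⟨e1, he1, hlt.le, he1y⟩
        have hlt' : e0 < g := lt_of_le_of_ne hg1 (fun h => Set.disjoint_left.1 hE (h ▸ he0) hg)
        have gap : ∀ w ∈ Set.Ioo e0 g, w ∉ E₀ ∧ w ∉ E₁ := fun w hw =>
          ⟨fun h => not_le.2 hw.1 (hmax0 w h (hw.2.le.trans hg2)),
            fun h => not_le.2 hw.2 (hgmin w h hw.1.le)⟩
        obtain ⟨w, hw, hwD⟩ := h₀₁ e0 g hxe0 hlt' (hg2.trans hyb) he0 hg gap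
        have hs := hsep e0 he0 g hg hxe0 (he0y.trans hyb)
        rw [abs_of_neg (by linarith)] at hs
        set m := (e0 + g) / 2 with hm
        have hmI : m ∈ Set.Ioo e0 g := ⟨by linarith, by linarith⟩
        have eqI : ∀ u ∈ Set.Ioo e0 g, ∀ v ∈ Set.Ioo e0 g, u ≤ v → W₀ u = W₀ v ∧ W₁ u = W₁ v :=
          fun u hu v hv huv =>
            ⟨hW₀ u v (hxe0.trans hu.1.le) huv (hv.2.le.trans (hg2.trans hyb))
              (fun w hw => (gap w ⟨hu.1.trans_le hw.1, hw.2.trans_lt hv.2⟩).1),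
            hW₁ u v (hxe0.trans hu.1.le) huv (hv.2.le.trans (hg2.trans hyb))
              (fun w hw => (gap w ⟨hu.1.trans_le hw.1, hw.2.trans_lt hv.2⟩).2)⟩
        have hmD : W₁ m ≤ W₀ m := by
          rcases le_total m w with h | h
          · obtain ⟨h1, h2⟩ := eqI m hmI w hw h
            rwa [h1, h2]
          · obtain ⟨h1, h2⟩ := eqI w hw m hmI h
            rwa [← h1, ← h2]
        have := ih m (hxe0.trans hmI.1.le) ((hmI.2.le.trans hg2).trans hyb) (by linarith)
          (gap m hmI).1 (gap m hmI).2 (Or.inr ⟨e0, he0, hxe0, hmI.1.le, fun w hw =>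
            (gap w ⟨hw.1, hw.2.trans_lt hmI.2⟩).2⟩)
        rw [← hyD, ← hW₀ m y (hxe0.trans hmI.1.le) (hmI.2.le.trans hg2) hyb (fun w hw h =>
          not_le.2 (hmI.1.trans_le hw.1) (hmax0 w h hw.2))]
        exact this.trans hmD
  obtain ⟨n, hn⟩ := exists_nat_ge ((b - x) / (δ / 2))
  exact main n b hxb le_rfl (by rwa [div_le_iff₀ (by positivity)] at hn) hb₀ hb₁ hb

theorem exists_log_difference {φ : ℝ → ℂ} (hφ : Continuous φ) (hinj : Set.InjOn φ (Set.Ici 0)) :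
    ∃ L : ℝ → ℝ → ℂ, (∀ x y, x < y → ContinuousAt (Function.uncurry L) (x, y)) ∧
      ∀ x y, 0 ≤ x → x < y → Complex.exp (L x y) = φ y - φ x := by
  obtain ⟨l, hl, he⟩ := exists_continuous_log
    (f := fun p : ℝ × ℝ => φ (|p.1| + Real.exp p.2) - φ |p.1|) (by fun_prop) (fun p h => by
      have := hinj (by simp; positivity) (by simp) (sub_eq_zero.1 h)
      linarith [Real.exp_pos p.2])
  refine ⟨fun x y => l (x, Real.log (y - x)), fun x y hxy => ?_, fun x y hx hxy => ?_⟩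
  · refine hl.continuousAt.comp (x := (x, y)) (f := fun p : ℝ × ℝ => (p.1, Real.log (p.2 - p.1)))
      (continuousAt_fst.prodMk (ContinuousAt.log (by fun_prop) (by simp; linarith)))
  · rw [he]
    simp only [abs_of_nonneg hx, Real.exp_log (sub_pos.2 hxy)]
    rw [add_sub_cancel]

/-- A two-sided logarithm of the difference of two points of a curve. -/
noncomputable def pairLog (L : ℝ → ℝ → ℂ) (r u : ℝ) : ℂ :=
  if u < r then L u r else L r u + Real.pi * Complex.I

theorem pairLog_of_lt {L : ℝ → ℝ → ℂ} {r u : ℝ} (h : u < r) : pairLog L r u = L u r := if_pos h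

theorem pairLog_of_gt {L : ℝ → ℝ → ℂ} {r u : ℝ} (h : r < u) :
    pairLog L r u = L r u + Real.pi * Complex.I := if_neg h.le.not_gt

theorem continuousAt_pairLog {L : ℝ → ℝ → ℂ}
    (hL : ∀ x y, x < y → ContinuousAt (Function.uncurry L) (x, y)) {r u : ℝ} (h : r ≠ u) :
    ContinuousAt (Function.uncurry (pairLog L)) (r, u) := by
  rcases lt_or_gt_of_ne h with h | h
  · have h1 : ∀ᶠ p : ℝ × ℝ in 𝓝 (r, u), p.1 < p.2 :=
      (isOpen_lt continuous_fst continuous_snd).mem_nhds h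
    refine ((hL r u h).add (continuousAt_const (y := Real.pi * Complex.I))).congr ?_
    filter_upwards [h1] with p hp
    exact (pairLog_of_gt hp).symm
  · have h1 : ∀ᶠ p : ℝ × ℝ in 𝓝 (r, u), p.2 < p.1 :=
      (isOpen_lt continuous_snd continuous_fst).mem_nhds h
    refine ((hL u r h).comp (x := (r, u)) (f := Prod.swap) continuous_swap.continuousAt).congr ?_
    filter_upwards [h1] with p hp
    exact (pairLog_of_lt hp).symm

theorem exp_pairLog {φ : ℝ → ℂ} {L : ℝ → ℝ → ℂ}
    (hL : ∀ x y, 0 ≤ x → x < y → Complex.exp (L x y) = φ y - φ x) {r u : ℝ} (hr : 0 ≤ r)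
    (hu : 0 ≤ u) (h : r ≠ u) : Complex.exp (pairLog L r u) = φ r - φ u := by
  rcases lt_or_gt_of_ne h with h | h
  · rw [pairLog_of_gt h, Complex.exp_add, hL r u hr h, Complex.exp_pi_mul_I]; ring
  · rw [pairLog_of_lt h, hL u r hu h]

theorem logVar_eq_pairLog {φ : ℝ → ℂ} {L : ℝ → ℝ → ℂ}
    (hLc : ∀ x y, x < y → ContinuousAt (Function.uncurry L) (x, y))
    (hL : ∀ x y, 0 ≤ x → x < y → Complex.exp (L x y) = φ y - φ x) {x y u : ℝ} (hx : 0 ≤ x)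
    (hxy : x ≤ y) (hu : 0 ≤ u) (h : u ∉ Set.Icc x y) :
    logVar (fun r => φ r - φ u) x y = pairLog L y u - pairLog L x u := by
  have hne : ∀ r ∈ Set.Icc x y, r ≠ u := by rintro r hr rfl; exact h hr
  refine logVar_eq (l := fun r => pairLog L r u) hxy (fun r hr => ?_) (fun r hr => ?_)
  · exact ((continuousAt_pairLog hLc (hne r hr)).comp (x := r) (f := fun r => (r, u))
      (by fun_prop)).continuousWithinAt
  · exact exp_pairLog hL (hx.trans hr.1) hu (hne r hr)

theorem norm_log_sub_log_le {f l : ℝ → ℂ} {A B m δ : ℝ} (hm : 0 < m) (hδ : δ ≤ m / 2)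
    (hf : ContinuousOn f (Set.Icc A B)) (hl : ContinuousOn l (Set.Icc A B))
    (he : ∀ r ∈ Set.Icc A B, Complex.exp (l r) = f r) {u v : ℝ} (hu : u ∈ Set.Icc A B)
    (hv : v ∈ Set.Icc A B) (hfm : m ≤ ‖f u‖) (h : ∀ r ∈ Set.uIcc u v, ‖f r - f u‖ ≤ δ) :
    ‖l v - l u‖ ≤ 3 * (δ / m) := by
  have hfu : f u ≠ 0 := fun h0 => by rw [h0, norm_zero] at hfm; linarith
  rcases le_total u v with huv | huv
  · have hs : Set.Icc u v ⊆ Set.Icc A B := Set.Icc_subset_Icc hu.1 hv.2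
    rw [Set.uIcc_of_le huv] at h
    have := norm_logVar_sub_logVar_le (g := fun _ => f u) huv hm hδ (hf.mono hs)
      continuousOn_const (fun _ _ => hfm) h
    rwa [logVar_const huv hfu, sub_zero, logVar_eq huv (hl.mono hs)
      (fun r hr => he r (hs hr))] at this
  · have hs : Set.Icc v u ⊆ Set.Icc A B := Set.Icc_subset_Icc hv.1 hu.2
    rw [Set.uIcc_of_ge huv] at h
    have := norm_logVar_sub_logVar_le (g := fun _ => f u) huv hm hδ (hf.mono hs)
      continuousOn_const (fun _ _ => hfm) h
    rwa [logVar_const huv hfu, sub_zero, logVar_eq huv (hl.mono hs)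
      (fun r hr => he r (hs hr)), norm_sub_rev] at this

/-- Comparison of the logarithmic variations along an arc and along a shadowing arc. -/
theorem norm_logVar_shadow_le {φ : ℝ → ℂ} (hφ : Continuous φ) {A B t x y x' y' m δ : ℝ}
    (hm : 0 < m) (hδ : δ ≤ m / 4) (hxy : x ≤ y) (hxy' : x' ≤ y') (hAx : A ≤ x) (hyB : y ≤ B)
    (hAx' : A ≤ x' - t) (hyB' : y' - t ≤ B) {z z' : ℂ} (hzz : ‖z' - z‖ ≤ δ)
    (hsh : ∀ r ∈ Set.Icc A B, ‖φ (r + t) - φ r‖ ≤ δ) (hz : ∀ r ∈ Set.Icc A B, m ≤ ‖φ r - z‖)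
    (hx : ∀ r ∈ Set.uIcc x (x' - t), ‖φ r - φ x‖ ≤ δ)
    (hy : ∀ r ∈ Set.uIcc y (y' - t), ‖φ r - φ y‖ ≤ δ) :
    ‖logVar (fun r => φ r - z') x' y' - logVar (fun r => φ r - z) x y‖ ≤ 12 * (δ / m) := by
  have hδ0 : 0 ≤ δ := (norm_nonneg _).trans hzz
  have hxI : x ∈ Set.Icc A B := ⟨hAx, hxy.trans hyB⟩
  have hyI : y ∈ Set.Icc A B := ⟨hAx.trans hxy, hyB⟩
  have hxI' : x' - t ∈ Set.Icc A B := ⟨hAx', by linarith⟩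
  have hyI' : y' - t ∈ Set.Icc A B := ⟨by linarith, hyB'⟩
  have hle' : x' - t ≤ y' - t := by linarith
  have hc : Continuous fun r => φ r - z := by fun_prop
  have hc' : Continuous fun r => φ r - z' := by fun_prop
  have hct : Continuous fun r => φ (r + t) - z' := by fun_prop
  have hsub : Set.Icc (x' - t) (y' - t) ⊆ Set.Icc A B := Set.Icc_subset_Icc hAx' hyB'
  have hbd : ∀ r ∈ Set.Icc A B, ‖(φ (r + t) - z') - (φ r - z)‖ ≤ 2 * δ := fun r hr => by
    have : (φ (r + t) - z') - (φ r - z) = (φ (r + t) - φ r) - (z' - z) := by ring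
    rw [this]
    exact (norm_sub_le _ _).trans (by linarith [hsh r hr])
  have h1 : logVar (fun r => φ r - z') x' y' =
      logVar (fun r => φ (r + t) - z') (x' - t) (y' - t) := by
    have := logVar_comp_add (fun r => φ r - z') t hle' (hc'.continuousOn)
      (fun r hr h0 => by
        rw [sub_add_cancel, sub_add_cancel] at hr
        have h2 := hbd (r - t) (hsub ⟨by linarith [hr.1], by linarith [hr.2]⟩)
        have h3 := hz (r - t) (hsub ⟨by linarith [hr.1], by linarith [hr.2]⟩)
        rw [sub_add_cancel, h0, zero_sub, norm_neg] at h2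
        linarith)
    rw [this, sub_add_cancel, sub_add_cancel]
  have h2 := norm_logVar_sub_logVar_le (f := fun r => φ (r + t) - z') (g := fun r => φ r - z)
    (δ := 2 * δ) hle' hm (by linarith) hct.continuousOn hc.continuousOn
    (fun r hr => hz r (hsub hr)) (fun r hr => hbd r (hsub hr))
  obtain ⟨l, hl, he⟩ := exists_continuousOn_log_Icc (x := A) (y := B) (by linarith)
    hc.continuousOn (fun r hr h0 => by
      have := hz r hr
      rw [h0, norm_zero] at this
      linarith)
  have h3 := norm_log_sub_log_le hm (by linarith) hc.continuousOn hl he hxI hxI' (hz x hxI)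
    (δ := δ) (fun r hr => by simpa using hx r hr)
  have h4 := norm_log_sub_log_le hm (by linarith) hc.continuousOn hl he hyI hyI' (hz y hyI)
    (δ := δ) (fun r hr => by simpa using hy r hr)
  rw [logVar_eq (l := l) hle' (hl.mono hsub) (fun r hr => he r (hsub hr))] at h2
  rw [h1, logVar_eq (l := l) hxy (hl.mono (Set.Icc_subset_Icc hAx hyB))
    (fun r hr => he r (Set.Icc_subset_Icc hAx hyB hr))]
  set q := logVar (fun r => φ (r + t) - z') (x' - t) (y' - t)
  have : q - (l y - l x) = (q - (l (y' - t) - l (x' - t))) + (l (y' - t) - l y)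
      - (l (x' - t) - l x) := by ring
  rw [this]
  refine (norm_sub_le _ _).trans ((add_le_add (norm_add_le _ _) le_rfl).trans ?_)
  have : 2 * δ / m = 2 * (δ / m) := by ring
  linarith

/-- Moving the base point inside a small connected set avoiding the arc, far from the ends of the
arc, changes the logarithmic variation only slightly. -/
theorem norm_logVar_sub_le_of_isPreconnected {f : ℝ → ℂ} {x y m δ : ℝ} (hxy : x ≤ y)
    (hf : ContinuousOn f (Set.Icc x y)) (hm : 0 < m) (hδ : δ ≤ m / 2) {Q : Set ℂ}
    (hQ : IsPreconnected Q) (hQf : ∀ w ∈ Q, w ∉ f '' Set.Icc x y) {z z' : ℂ} (hz : z ∈ Q)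
    (hz' : z' ∈ Q) (hQδ : ∀ w ∈ Q, ‖w - z'‖ ≤ δ) (hmx : m ≤ ‖f x - z'‖) (hmy : m ≤ ‖f y - z'‖) :
    ‖logVar (fun r => f r - z) x y - logVar (fun r => f r - z') x y‖ ≤ 3 * (δ / m) := by
  have hδ0 : 0 ≤ δ := (norm_nonneg _).trans (hQδ z hz)
  have ne : ∀ {u : ℝ}, m ≤ ‖f u - z'‖ → f u - z' ≠ 0 := fun h h0 => by
    rw [h0, norm_zero] at h; linarith
  have hs : ∀ {u : ℝ}, m ≤ ‖f u - z'‖ → ∀ w ∈ Q, (f u - w) / (f u - z') ∈ Complex.slitPlane :=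
    fun h w hw => div_mem_slitPlane (by
      rw [sub_sub_sub_cancel_left, norm_sub_rev]
      linarith [hQδ w hw])
  have hv : ∀ w ∈ Q, ∀ r ∈ Set.Icc x y, f r - w ≠ 0 := fun w hw r hr h0 =>
    hQf w hw ⟨r, hr, sub_eq_zero.1 h0⟩
  have hx := Set.left_mem_Icc.2 hxy
  have hy := Set.right_mem_Icc.2 hxy
  have key := hQ.eq_of_exp_eq_one
    (f := fun w => logVar (fun r => f r - w) x y - logVar (fun r => f r - z') x y
      - Complex.log ((f y - w) / (f y - z')) + Complex.log ((f x - w) / (f x - z')))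
    (by
      refine ContinuousOn.add (ContinuousOn.sub (ContinuousOn.sub (fun w hw => ?_)
        continuousOn_const) ?_) ?_
      · exact (continuousAt_logVar_sub hxy hf (hQf w hw)).continuousWithinAt
      · exact ContinuousOn.clog (by fun_prop) (hs hmy)
      · exact ContinuousOn.clog (by fun_prop) (hs hmx))
    (fun w hw => by
      have n1 := hv w hw x hx
      have n2 := hv w hw y hy
      have n3 := ne hmx
      have n4 := ne hmy
      rw [Complex.exp_add, Complex.exp_sub, Complex.exp_sub,
        exp_logVar (f := fun r => f r - w) hxy (hf.sub continuousOn_const) (hv w hw),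
        exp_logVar (f := fun r => f r - z') hxy (hf.sub continuousOn_const) (hv z' hz'),
        Complex.exp_log (Complex.slitPlane_ne_zero (hs hmy w hw)),
        Complex.exp_log (Complex.slitPlane_ne_zero (hs hmx w hw))]
      field_simp) hz hz'
  simp only [div_self (ne hmx), div_self (ne hmy), Complex.log_one, sub_self, add_zero] at key
  have e : logVar (fun r => f r - z) x y - logVar (fun r => f r - z') x y =
      Complex.log ((f y - z) / (f y - z')) - Complex.log ((f x - z) / (f x - z')) := by
    linear_combination key
  have b : ∀ {u : ℝ}, m ≤ ‖f u - z'‖ →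
      ‖Complex.log ((f u - z) / (f u - z'))‖ ≤ 3 / 2 * (δ / m) := fun {u} h => by
    have h1 : ‖(f u - z) - (f u - z')‖ ≤ δ := by
      rw [sub_sub_sub_cancel_left, norm_sub_rev]; exact hQδ z hz
    exact (norm_log_div_le hm h (h1.trans hδ)).trans (by gcongr)
  rw [e]
  refine (norm_sub_le _ _).trans ?_
  linarith [b hmx, b hmy]

/-- A segment joining two disjoint compact sets contains a subsegment joining them and meeting
each of them in one endpoint only. -/
theorem exists_clean_segment {K₁ K₂ : Set ℂ} (h₁ : IsClosed K₁) (h₂ : IsClosed K₂) {P Q : ℂ}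
    (hP : P ∈ K₁) (hQ : Q ∈ K₂) :
    ∃ P' ∈ K₁, ∃ Q' ∈ K₂, P' ∈ segment ℝ P Q ∧ Q' ∈ segment ℝ P Q ∧
      (∀ w ∈ segment ℝ P' Q', w ∈ K₁ → w = P') ∧ (∀ w ∈ segment ℝ P' Q', w ∈ K₂ → w = Q') := by
  have hseg : IsCompact (segment ℝ P Q) := by
    rw [segment_eq_image_lineMap]; exact isCompact_Icc.image (by fun_prop)
  obtain ⟨⟨P', Q'⟩, ⟨⟨hP1, hP2⟩, hQ1, hQ2⟩, hmin⟩ :=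
    ((hseg.inter_right h₁).prod (hseg.inter_right h₂)).exists_isMinOn
      ⟨(P, Q), ⟨left_mem_segment ℝ P Q, hP⟩, ⟨right_mem_segment ℝ P Q, hQ⟩⟩
      (f := fun p : ℂ × ℂ => dist p.1 p.2) (by fun_prop)
  have hsub : segment ℝ P' Q' ⊆ segment ℝ P Q := (convex_segment P Q).segment_subset hP1 hQ1
  refine ⟨P', hP2, Q', hQ2, hP1, hQ1, fun w hw hwK => ?_, fun w hw hwK => ?_⟩
  · have h1 : dist P' Q' ≤ dist w Q' := isMinOn_iff.1 hmin (w, Q') ⟨⟨hsub hw, hwK⟩, hQ1, hQ2⟩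
    have h2 := dist_add_dist_of_mem_segment hw
    exact (dist_le_zero.1 (by linarith)).symm
  · have h1 : dist P' Q' ≤ dist P' w := isMinOn_iff.1 hmin (P', w) ⟨⟨hP1, hP2⟩, hsub hw, hwK⟩
    have h2 := dist_add_dist_of_mem_segment hw
    exact dist_le_zero.1 (by linarith)

/-- A ladder on an arc of a curve and a shadowing later arc, with a third transverse segment in the
middle. -/
structure IsConfig (φ : ℝ → ℂ) (e t s₀ sₘ s₁ t₀ tₘ t₁ η : ℝ) : Prop where
  lad : IsLadder φ s₀ s₁ t₀ t₁
  pos : 0 < η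
  s0m : s₀ < sₘ
  sm1 : sₘ < s₁
  t0m : t₀ < tₘ
  tm1 : tₘ < t₁
  s1e : s₁ ≤ e
  tt0 : t ≤ t₀
  t1e : t₁ - t ≤ e
  shadow : ∀ r ∈ Set.Icc 0 e, ‖φ (r + t) - φ r‖ ≤ η / 1000
  near0 : ∀ r ∈ Set.uIcc s₀ (t₀ - t), ‖φ r - φ s₀‖ ≤ η / 1000
  nearm : ∀ r ∈ Set.uIcc sₘ (tₘ - t), ‖φ r - φ sₘ‖ ≤ η / 1000
  near1 : ∀ r ∈ Set.uIcc s₁ (t₁ - t), ‖φ r - φ s₁‖ ≤ η / 1000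
  seg0 : ‖φ t₀ - φ s₀‖ ≤ η / 1000
  segm : ‖φ tₘ - φ sₘ‖ ≤ η / 1000
  seg1 : ‖φ t₁ - φ s₁‖ ≤ η / 1000
  sep0 : ∀ r ∈ Set.Icc (min sₘ (tₘ - t)) (max s₁ (t₁ - t)), η ≤ ‖φ r - φ s₀‖
  sep1 : ∀ r ∈ Set.Icc (min s₀ (t₀ - t)) (max sₘ (tₘ - t)), η ≤ ‖φ r - φ s₁‖
  clean_s : ∀ r ∈ Set.Icc s₀ s₁, φ r ∈ segment ℝ (φ sₘ) (φ tₘ) → r = sₘ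
  clean_t : ∀ r ∈ Set.Icc t₀ t₁, φ r ∈ segment ℝ (φ sₘ) (φ tₘ) → r = tₘ

theorem norm_sub_left_le_of_mem_segment {P Q w : ℂ} (hw : w ∈ segment ℝ P Q) :
    ‖w - P‖ ≤ ‖Q - P‖ := by
  have h := dist_add_dist_of_mem_segment hw
  rw [dist_eq_norm, dist_eq_norm, dist_eq_norm] at h
  rw [norm_sub_rev w P, norm_sub_rev Q P]
  linarith [norm_nonneg (w - Q)]

/-- The variation of the logarithm along a rail, closed up by the segment joining its ends. -/
noncomputable def railVar (φ : ℝ → ℂ) (L : ℝ → ℝ → ℂ) (s t u : ℝ) : ℂ :=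
  pairLog L t u - pairLog L s u - segLog (φ s) (φ t) (φ u)

theorem railVar_sub_railVar {φ : ℝ → ℂ} {L : ℝ → ℝ → ℂ}
    (hLc : ∀ x y, x < y → ContinuousAt (Function.uncurry L) (x, y))
    (hL : ∀ x y, 0 ≤ x → x < y → Complex.exp (L x y) = φ y - φ x)
    {s₀ s₁ t₀ t₁ : ℝ} (h : IsLadder φ s₀ s₁ t₀ t₁) {u : ℝ} (hu : 0 ≤ u)
    (hus : u ∉ Set.Icc s₀ s₁) (hut : u ∉ Set.Icc t₀ t₁) :
    railVar φ L s₀ t₀ u - railVar φ L s₁ t₁ u = ladderVar φ s₀ s₁ t₀ t₁ (φ u) := by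
  have ht0 : 0 ≤ t₀ := h.nonneg.trans (h.lt_s.le.trans h.lt_st.le)
  rw [railVar, railVar, ladderVar, logVar_eq_pairLog hLc hL h.nonneg h.lt_s.le hu hus,
    logVar_eq_pairLog hLc hL ht0 h.lt_t.le hu hut]
  ring

theorem exp_railVar {φ : ℝ → ℂ} {L : ℝ → ℝ → ℂ}
    (hL : ∀ x y, 0 ≤ x → x < y → Complex.exp (L x y) = φ y - φ x)
    {s t u : ℝ} (hs : 0 ≤ s) (ht : 0 ≤ t) (hu : 0 ≤ u) (h : φ u ∉ segment ℝ (φ s) (φ t)) :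
    Complex.exp (railVar φ L s t u) = 1 := by
  have h1 := sub_ne_zero_of_notMem_segment_left h
  have h2 := sub_ne_zero_of_notMem_segment_right h
  have n1 : s ≠ u := by rintro rfl; simp at h1
  have n2 : t ≠ u := by rintro rfl; simp at h2
  rw [railVar, Complex.exp_sub, Complex.exp_sub, exp_segLog h, exp_pairLog hL ht hu n2,
    exp_pairLog hL hs hu n1, div_self]
  exact div_ne_zero h2 h1

theorem continuousAt_railVar {φ : ℝ → ℂ} (hφ : Continuous φ) {L : ℝ → ℝ → ℂ}
    (hLc : ∀ x y, x < y → ContinuousAt (Function.uncurry L) (x, y))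
    {s t u : ℝ} (h : φ u ∉ segment ℝ (φ s) (φ t)) : ContinuousAt (railVar φ L s t) u := by
  have h1 := sub_ne_zero_of_notMem_segment_left h
  have h2 := sub_ne_zero_of_notMem_segment_right h
  have n1 : s ≠ u := by rintro rfl; simp at h1
  have n2 : t ≠ u := by rintro rfl; simp at h2
  refine (ContinuousAt.sub ?_ ?_).sub ?_
  · exact (continuousAt_pairLog hLc n2).comp (x := u) (f := fun u => (t, u)) (by fun_prop)
  · exact (continuousAt_pairLog hLc n1).comp (x := u) (f := fun u => (s, u)) (by fun_prop)
  · exact (continuousAt_segLog h).comp (x := u) hφ.continuousAt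

theorem railVar_eq {φ : ℝ → ℂ} (hφ : Continuous φ) {L : ℝ → ℝ → ℂ}
    (hLc : ∀ x y, x < y → ContinuousAt (Function.uncurry L) (x, y))
    (hL : ∀ x y, 0 ≤ x → x < y → Complex.exp (L x y) = φ y - φ x)
    {s t u v : ℝ} (hs : 0 ≤ s) (ht : 0 ≤ t) (hu : 0 ≤ u) (huv : u ≤ v)
    (h : ∀ w ∈ Set.Icc u v, φ w ∉ segment ℝ (φ s) (φ t)) :
    railVar φ L s t u = railVar φ L s t v :=
  isPreconnected_Icc.eq_of_exp_eq_one
    (fun w hw => (continuousAt_railVar hφ hLc (h w hw)).continuousWithinAt)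
    (fun w hw => exp_railVar hL hs ht (hu.trans hw.1) (h w hw)) (Set.left_mem_Icc.2 huv)
    (Set.right_mem_Icc.2 huv)

theorem norm_segLog_le {P Q z : ℂ} {m δ : ℝ} (hm : 0 < m) (hδ : δ ≤ m / 2) (hPQ : ‖Q - P‖ ≤ δ)
    (hz : m ≤ ‖P - z‖) : ‖segLog P Q z‖ ≤ 3 / 2 * (δ / m) := by
  have h1 : ‖(Q - z) - (P - z)‖ ≤ δ := by rwa [sub_sub_sub_cancel_right]
  exact (norm_log_div_le hm hz (h1.trans hδ)).trans (by gcongr)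

namespace IsConfig

variable {φ : ℝ → ℂ} {e t s₀ sₘ s₁ t₀ tₘ t₁ η : ℝ}

theorem ladderVar_eq_zero (h : IsConfig φ e t s₀ sₘ s₁ t₀ tₘ t₁ η) {z : ℂ}
    (hz : ∀ r ∈ Set.Icc (min s₀ (t₀ - t)) (max s₁ (t₁ - t)), η / 2 ≤ ‖φ r - z‖) :
    z ∉ ladderRim φ s₀ s₁ t₀ t₁ ∧ ladderVar φ s₀ s₁ t₀ t₁ z = 0 := by
  have hη := h.pos
  have hJ : Set.Icc (min s₀ (t₀ - t)) (max s₁ (t₁ - t)) ⊆ Set.Icc 0 e :=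
    Set.Icc_subset_Icc (le_min h.lad.nonneg (by linarith [h.tt0])) (max_le h.s1e h.t1e)
  have hs := h.lad.lt_s
  have ht := h.lad.lt_t
  have m0 : s₀ ∈ Set.Icc (min s₀ (t₀ - t)) (max s₁ (t₁ - t)) :=
    ⟨min_le_left _ _, hs.le.trans (le_max_left _ _)⟩
  have m1 : s₁ ∈ Set.Icc (min s₀ (t₀ - t)) (max s₁ (t₁ - t)) :=
    ⟨(min_le_left _ _).trans hs.le, le_max_left _ _⟩
  have hrim : z ∉ ladderRim φ s₀ s₁ t₀ t₁ := by
    rw [IsLadder.notMem_rim_iff]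
    refine ⟨?_, ?_, ?_, ?_⟩
    · rintro ⟨r, hr, rfl⟩
      have := hz r ⟨(min_le_left _ _).trans hr.1, hr.2.trans (le_max_left _ _)⟩
      rw [sub_self, norm_zero] at this
      linarith
    · rintro ⟨r, hr, rfl⟩
      have hr' : r - t ∈ Set.Icc (min s₀ (t₀ - t)) (max s₁ (t₁ - t)) :=
        ⟨(min_le_right _ _).trans (by linarith [hr.1]),
          le_trans (by linarith [hr.2]) (le_max_right _ _)⟩
      have h1 := hz _ hr'
      have h2 := h.shadow _ (hJ hr')
      rw [sub_add_cancel, norm_sub_rev] at h2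
      linarith
    · intro hw
      have h1 := (norm_sub_left_le_of_mem_segment hw).trans h.seg0
      have h2 := hz s₀ m0
      rw [norm_sub_rev] at h2
      linarith
    · intro hw
      have h1 := (norm_sub_left_le_of_mem_segment hw).trans h.seg1
      have h2 := hz s₁ m1
      rw [norm_sub_rev] at h2
      linarith
  refine ⟨hrim, eq_zero_of_exp_eq_one_of_norm_lt (h.lad.exp_var hrim) ?_⟩
  have h1 := norm_logVar_shadow_le h.lad.cont (z := z) (z' := z) (t := t) (half_pos hη)
    (δ := η / 1000) (by linarith) hs.le ht.le (min_le_left _ _)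
    (le_max_left _ _) (min_le_right _ _) (le_max_right _ _) (by simp; positivity)
    (fun r hr => h.shadow r (hJ hr)) hz h.near0 h.near1
  have h2 := norm_segLog_le (half_pos hη) (by linarith) h.seg0 (hz s₀ m0)
  have h3 := norm_segLog_le (half_pos hη) (by linarith) h.seg1 (hz s₁ m1)
  have e1 : η / 1000 / (η / 2) = 1 / 500 := by field_simp; norm_num
  rw [e1] at h1 h2 h3
  rw [norm_sub_rev] at h1
  rw [ladderVar]
  refine (norm_add_le _ _).trans_lt ?_
  have := norm_sub_le (logVar (fun r => φ r - z) s₀ s₁ - logVar (fun r => φ r - z) t₀ t₁)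
    (segLog (φ s₀) (φ t₀) z)
  linarith

theorem notMem_segment_of_far {P Q z : ℂ} {δ m : ℝ} (hPQ : ‖Q - P‖ ≤ δ) (hδ : δ < m)
    (hz : m ≤ ‖z - P‖) : z ∉ segment ℝ P Q := fun hw => by
  have := norm_sub_left_le_of_mem_segment hw
  linarith

/-- The center of the middle segment. -/
noncomputable def center (φ : ℝ → ℂ) (sₘ tₘ : ℝ) : ℂ := midpoint ℝ (φ sₘ) (φ tₘ)

theorem dist_s0_sm (h : IsConfig φ e t s₀ sₘ s₁ t₀ tₘ t₁ η) : η ≤ ‖φ sₘ - φ s₀‖ :=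
  h.sep0 _ ⟨min_le_left _ _, h.sm1.le.trans (le_max_left _ _)⟩

theorem dist_s1_sm (h : IsConfig φ e t s₀ sₘ s₁ t₀ tₘ t₁ η) : η ≤ ‖φ sₘ - φ s₁‖ :=
  h.sep1 _ ⟨(min_le_left _ _).trans h.s0m.le, le_max_left _ _⟩

/-- Points near the middle segment are far from the two end segments. -/
theorem far_of_near_sm (h : IsConfig φ e t s₀ sₘ s₁ t₀ tₘ t₁ η) {z : ℂ}
    (hz : ‖z - φ sₘ‖ ≤ η / 1000) : η / 2 ≤ ‖φ s₀ - z‖ ∧ η / 2 ≤ ‖φ s₁ - z‖ ∧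
      η / 2 ≤ ‖φ t₀ - z‖ ∧ η / 2 ≤ ‖φ t₁ - z‖ := by
  have hη := h.pos
  have h1 := h.dist_s0_sm
  have h2 := h.dist_s1_sm
  have tri : ∀ a b c : ℂ, ‖a - b‖ ≤ ‖c - b‖ + ‖c - a‖ := fun a b c => by
    have : a - b = (c - b) - (c - a) := by ring
    rw [this]; exact norm_sub_le _ _
  have a0 := tri (φ sₘ) (φ s₀) z
  have a1 := tri (φ sₘ) (φ s₁) z
  have b0 := tri (φ s₀) z (φ t₀)
  have b1 := tri (φ s₁) z (φ t₁)
  rw [norm_sub_rev z (φ s₀)] at a0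
  rw [norm_sub_rev z (φ s₁)] at a1
  have := h.seg0
  have := h.seg1
  refine ⟨?_, ?_, ?_, ?_⟩ <;> linarith

theorem notMem_of_near_sm (h : IsConfig φ e t s₀ sₘ s₁ t₀ tₘ t₁ η) {z : ℂ}
    (hz : ‖z - φ sₘ‖ ≤ η / 1000) : z ∉ segment ℝ (φ s₀) (φ t₀) ∧
      z ∉ segment ℝ (φ s₁) (φ t₁) := by
  have hη := h.pos
  obtain ⟨h1, h2, -, -⟩ := h.far_of_near_sm hz
  rw [norm_sub_rev] at h1 h2
  exact ⟨notMem_segment_of_far h.seg0 (by linarith) h1,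
    notMem_segment_of_far h.seg1 (by linarith) h2⟩

theorem sm_ne_tm (h : IsConfig φ e t s₀ sₘ s₁ t₀ tₘ t₁ η) : φ sₘ ≠ φ tₘ := fun heq => by
  have h0 := h.lad.nonneg
  have h1 := h.lad.lt_st
  have h2 := h.s0m
  have h3 := h.sm1
  have h4 := h.t0m
  have := h.lad.inj (Set.mem_Ici.2 (by linarith)) (Set.mem_Ici.2 (by linarith)) heq
  linarith

theorem center_mem (φ : ℝ → ℂ) (sₘ tₘ : ℝ) : center φ sₘ tₘ ∈ segment ℝ (φ sₘ) (φ tₘ) :=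
  midpoint_mem_segment _ _

theorem notMem_segment_center {P Q : ℂ} (hPQ : P ≠ Q) : P ∉ segment ℝ (midpoint ℝ P Q) Q := by
  intro hw
  have h1 := dist_add_dist_of_mem_segment hw
  rw [dist_midpoint_left, dist_midpoint_right] at h1
  have h2 : 0 < dist P Q := dist_pos.2 hPQ
  linarith

theorem near_center (h : IsConfig φ e t s₀ sₘ s₁ t₀ tₘ t₁ η) {w : ℂ}
    (hw : w ∈ segment ℝ (φ sₘ) (φ tₘ)) : ‖w - φ sₘ‖ ≤ η / 1000 :=
  (norm_sub_left_le_of_mem_segment hw).trans h.segm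

theorem center_notMem (h : IsConfig φ e t s₀ sₘ s₁ t₀ tₘ t₁ η) :
    center φ sₘ tₘ ∉ ladderRim φ s₀ s₁ t₀ t₁ := by
  rw [IsLadder.notMem_rim_iff]
  refine ⟨?_, ?_, h.notMem_of_near_sm (h.near_center (center_mem _ _ _))⟩
  · rintro ⟨r, hr, hre⟩
    have := h.clean_s r hr (by rw [hre]; exact center_mem _ _ _)
    subst this
    exact h.sm_ne_tm (left_eq_midpoint_iff (R := ℝ).1 hre)
  · rintro ⟨r, hr, hre⟩
    have := h.clean_t r hr (by rw [hre]; exact center_mem _ _ _)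
    subst this
    exact h.sm_ne_tm (right_eq_midpoint_iff (R := ℝ).1 hre)

/-- The arc through `sₘ`, seen from the center and from `φ tₘ`. -/
theorem norm_logVar_s_center (h : IsConfig φ e t s₀ sₘ s₁ t₀ tₘ t₁ η) :
    ‖logVar (fun r => φ r - center φ sₘ tₘ) s₀ s₁ - logVar (fun r => φ r - φ tₘ) s₀ s₁‖
      ≤ 3 / 500 := by
  have hη := h.pos
  have hsub : segment ℝ (center φ sₘ tₘ) (φ tₘ) ⊆ segment ℝ (φ sₘ) (φ tₘ) :=
    (convex_segment _ _).segment_subset (center_mem _ _ _) (right_mem_segment ℝ _ _)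
  obtain ⟨f0, f1, -, -⟩ := h.far_of_near_sm (z := φ tₘ) h.segm
  have := norm_logVar_sub_le_of_isPreconnected h.lad.lt_s.le h.lad.cont.continuousOn
    (half_pos hη) (δ := η / 1000) (by linarith)
    (convex_segment (center φ sₘ tₘ) (φ tₘ)).isPreconnected
    (fun w hw => by
      rintro ⟨r, hr, rfl⟩
      have := h.clean_s r hr (hsub hw)
      subst this
      exact notMem_segment_center h.sm_ne_tm hw)
    (left_mem_segment ℝ _ _) (right_mem_segment ℝ _ _)
    (fun w hw => by
      have h1 := norm_sub_left_le_of_mem_segment (segment_symm ℝ (φ sₘ) (φ tₘ) ▸ hsub hw)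
      rw [norm_sub_rev (φ sₘ)] at h1
      exact h1.trans h.segm) f0 f1
  refine this.trans (le_of_eq ?_)
  field_simp
  norm_num

theorem norm_logVar_t_center (h : IsConfig φ e t s₀ sₘ s₁ t₀ tₘ t₁ η) :
    ‖logVar (fun r => φ r - center φ sₘ tₘ) t₀ t₁ - logVar (fun r => φ r - φ sₘ) t₀ t₁‖
      ≤ 3 / 500 := by
  have hη := h.pos
  have hsub : segment ℝ (center φ sₘ tₘ) (φ sₘ) ⊆ segment ℝ (φ sₘ) (φ tₘ) :=
    (convex_segment _ _).segment_subset (center_mem _ _ _) (left_mem_segment ℝ _ _)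
  obtain ⟨-, -, f0, f1⟩ := h.far_of_near_sm (z := φ sₘ) (by simp; positivity)
  have := norm_logVar_sub_le_of_isPreconnected h.lad.lt_t.le h.lad.cont.continuousOn
    (half_pos hη) (δ := η / 1000) (by linarith)
    (convex_segment (center φ sₘ tₘ) (φ sₘ)).isPreconnected
    (fun w hw => by
      rintro ⟨r, hr, rfl⟩
      have := h.clean_t r hr (hsub hw)
      subst this
      rw [center, midpoint_comm] at hw
      exact notMem_segment_center h.sm_ne_tm.symm hw)
    (left_mem_segment ℝ _ _) (right_mem_segment ℝ _ _)
    (fun w hw => h.near_center (hsub hw)) f0 f1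
  refine this.trans (le_of_eq ?_)
  field_simp
  norm_num

theorem norm_segLog_near (h : IsConfig φ e t s₀ sₘ s₁ t₀ tₘ t₁ η) {z : ℂ}
    (hz : ‖z - φ sₘ‖ ≤ η / 1000) :
    ‖segLog (φ s₀) (φ t₀) z‖ ≤ 3 / 1000 ∧ ‖segLog (φ s₁) (φ t₁) z‖ ≤ 3 / 1000 := by
  have hη := h.pos
  obtain ⟨f0, f1, -, -⟩ := h.far_of_near_sm hz
  have e1 : 3 / 2 * (η / 1000 / (η / 2)) = 3 / 1000 := by field_simp
  have h2 := norm_segLog_le (half_pos hη) (by linarith) h.seg0 f0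
  have h3 := norm_segLog_le (half_pos hη) (by linarith) h.seg1 f1
  rw [e1] at h2 h3
  exact ⟨h2, h3⟩

/-- The upper half of the rails, seen from near `φ s₀`. -/
theorem norm_logVar_upper (h : IsConfig φ e t s₀ sₘ s₁ t₀ tₘ t₁ η) {z : ℂ}
    (hz : ‖z - φ s₀‖ ≤ η / 1000) :
    ‖logVar (fun r => φ r - z) tₘ t₁ - logVar (fun r => φ r - φ s₀) sₘ s₁‖ ≤ 12 / 1000 := by
  have hη := h.pos
  have h0 := h.lad.nonneg
  refine (norm_logVar_shadow_le h.lad.cont (z := φ s₀) (z' := z) (t := t) hη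
    (δ := η / 1000) (by linarith) h.sm1.le h.tm1.le (min_le_left _ _)
    (le_max_left _ _) (min_le_right _ _) (le_max_right _ _) hz
    (fun r hr => h.shadow r ?_) h.sep0 h.nearm h.near1).trans (le_of_eq ?_)
  · exact Set.Icc_subset_Icc (le_min (by linarith [h.s0m]) (by linarith [h.tt0, h.t0m]))
      (max_le h.s1e h.t1e) hr
  · field_simp

theorem norm_logVar_lower (h : IsConfig φ e t s₀ sₘ s₁ t₀ tₘ t₁ η) {z : ℂ}
    (hz : ‖z - φ s₁‖ ≤ η / 1000) :
    ‖logVar (fun r => φ r - z) t₀ tₘ - logVar (fun r => φ r - φ s₁) s₀ sₘ‖ ≤ 12 / 1000 := by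
  have hη := h.pos
  have h0 := h.lad.nonneg
  refine (norm_logVar_shadow_le h.lad.cont (z := φ s₁) (z' := z) (t := t) hη
    (δ := η / 1000) (by linarith) h.s0m.le h.t0m.le (min_le_left _ _)
    (le_max_left _ _) (min_le_right _ _) (le_max_right _ _) hz
    (fun r hr => h.shadow r ?_) h.sep1 h.near0 h.nearm).trans (le_of_eq ?_)
  · exact Set.Icc_subset_Icc (le_min h0 (by linarith [h.tt0]))
      (max_le (by linarith [h.sm1, h.s1e]) (by linarith [h.tm1, h.t1e])) hr
  · field_simp

end IsConfig

theorem logVar_eq_of_lt {φ : ℝ → ℂ} {L : ℝ → ℝ → ℂ}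
    (hLc : ∀ x y, x < y → ContinuousAt (Function.uncurry L) (x, y))
    (hL : ∀ x y, 0 ≤ x → x < y → Complex.exp (L x y) = φ y - φ x) {x y u : ℝ}
    (hxy : x ≤ y) (hu : 0 ≤ u) (h : u < x) :
    logVar (fun r => φ r - φ u) x y = L u y - L u x := by
  rw [logVar_eq_pairLog hLc hL (hu.trans h.le) hxy hu (fun h' => h.not_ge h'.1),
    pairLog_of_lt h, pairLog_of_lt (h.trans_le hxy)]

theorem logVar_eq_of_gt {φ : ℝ → ℂ} {L : ℝ → ℝ → ℂ}
    (hLc : ∀ x y, x < y → ContinuousAt (Function.uncurry L) (x, y))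
    (hL : ∀ x y, 0 ≤ x → x < y → Complex.exp (L x y) = φ y - φ x) {x y u : ℝ} (hx : 0 ≤ x)
    (hxy : x ≤ y) (h : y < u) :
    logVar (fun r => φ r - φ u) x y = L y u - L x u := by
  rw [logVar_eq_pairLog hLc hL hx hxy (hx.trans (hxy.trans h.le)) (fun h' => h.not_ge h'.2),
    pairLog_of_gt h, pairLog_of_gt (hxy.trans_lt h)]
  ring

namespace IsConfig

variable {φ : ℝ → ℂ} {e t s₀ sₘ s₁ t₀ tₘ t₁ η : ℝ}

theorem norm_logVar_upper_s (h : IsConfig φ e t s₀ sₘ s₁ t₀ tₘ t₁ η) :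
    ‖logVar (fun r => φ r - φ t₀) sₘ s₁ - logVar (fun r => φ r - φ s₀) sₘ s₁‖ ≤ 3 / 1000 := by
  have hη := h.pos
  have hc := h.lad.cont
  refine (norm_logVar_sub_logVar_le (m := η) (δ := η / 1000) h.sm1.le hη (by linarith)
    (by fun_prop) (by fun_prop) (fun r hr => h.sep0 r ⟨(min_le_left _ _).trans hr.1,
      hr.2.trans (le_max_left _ _)⟩) (fun r _ => ?_)).trans (le_of_eq (by field_simp))
  rw [sub_sub_sub_cancel_left, norm_sub_rev]
  exact h.seg0

theorem norm_logVar_lower_s (h : IsConfig φ e t s₀ sₘ s₁ t₀ tₘ t₁ η) :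
    ‖logVar (fun r => φ r - φ t₁) s₀ sₘ - logVar (fun r => φ r - φ s₁) s₀ sₘ‖ ≤ 3 / 1000 := by
  have hη := h.pos
  have hc := h.lad.cont
  refine (norm_logVar_sub_logVar_le (m := η) (δ := η / 1000) h.s0m.le hη (by linarith)
    (by fun_prop) (by fun_prop) (fun r hr => h.sep1 r ⟨(min_le_left _ _).trans hr.1,
      hr.2.trans (le_max_left _ _)⟩) (fun r _ => ?_)).trans (le_of_eq (by field_simp))
  rw [sub_sub_sub_cancel_left, norm_sub_rev]
  exact h.seg1

/-- The jumps at `sₘ` and `tₘ` add up to the variation of the rim around the center. -/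
theorem jump_add_jump (h : IsConfig φ e t s₀ sₘ s₁ t₀ tₘ t₁ η) {L : ℝ → ℝ → ℂ}
    (hLc : ∀ x y, x < y → ContinuousAt (Function.uncurry L) (x, y))
    (hL : ∀ x y, 0 ≤ x → x < y → Complex.exp (L x y) = φ y - φ x) :
    (railVar φ L s₀ t₀ sₘ - railVar φ L s₁ t₁ sₘ) + (railVar φ L s₀ t₀ tₘ - railVar φ L s₁ t₁ tₘ)
      = ladderVar φ s₀ s₁ t₀ t₁ (center φ sₘ tₘ) := by
  have hη := h.pos
  have o0 := h.lad.nonneg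
  have o1 := h.s0m
  have o2 := h.sm1
  have o3 := h.lad.lt_st
  have o4 := h.t0m
  have o5 := h.tm1
  have nsm := h.notMem_of_near_sm (z := φ sₘ) (by simp; positivity)
  have ntm := h.notMem_of_near_sm (z := φ tₘ) h.segm
  rw [← sub_eq_zero]
  apply eq_zero_of_exp_eq_one_of_norm_lt
  · rw [Complex.exp_sub, Complex.exp_add, Complex.exp_sub, Complex.exp_sub,
      h.lad.exp_var h.center_notMem, exp_railVar hL o0 (by linarith) (by linarith) nsm.1,
      exp_railVar hL (by linarith) (by linarith) (by linarith) nsm.2,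
      exp_railVar hL o0 (by linarith) (by linarith) ntm.1,
      exp_railVar hL (by linarith) (by linarith) (by linarith) ntm.2]
    norm_num
  · have E1 := logVar_eq_of_gt hLc hL (x := s₀) (y := s₁) (u := tₘ) o0 (by linarith) (by linarith)
    have E2 := logVar_eq_of_lt hLc hL (x := t₀) (y := t₁) (u := sₘ) (by linarith) (by linarith)
      (by linarith)
    have E3 := logVar_eq_of_lt hLc hL (x := sₘ) (y := s₁) (u := s₀) o2.le o0 o1
    have E4 := logVar_eq_of_gt hLc hL (x := s₀) (y := sₘ) (u := s₁) o0 o1.le o2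
    have E5 := logVar_eq_of_lt hLc hL (x := tₘ) (y := t₁) (u := t₀) o5.le (by linarith) o4
    have E6 := logVar_eq_of_gt hLc hL (x := t₀) (y := tₘ) (u := t₁) (by linarith) o4.le o5
    have C1 := h.norm_logVar_upper (z := φ t₀) h.seg0
    have C2 := h.norm_logVar_lower (z := φ t₁) h.seg1
    have C3 := h.norm_logVar_s_center
    have C4 := h.norm_logVar_t_center
    obtain ⟨S1, S2⟩ := h.norm_segLog_near (z := φ sₘ) (by simp; positivity)
    obtain ⟨S3, S4⟩ := h.norm_segLog_near (z := φ tₘ) h.segm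
    obtain ⟨S5, S6⟩ := h.norm_segLog_near (h.near_center (center_mem φ sₘ tₘ))
    rw [E5, E3] at C1
    rw [E6, E4] at C2
    rw [E1] at C3
    rw [E2] at C4
    rw [railVar, railVar, railVar, railVar, ladderVar, pairLog_of_lt (by linarith : sₘ < t₀),
      pairLog_of_gt o1, pairLog_of_lt (by linarith : sₘ < t₁), pairLog_of_lt o2, pairLog_of_gt o4,
      pairLog_of_gt (by linarith : s₀ < tₘ), pairLog_of_lt o5,
      pairLog_of_gt (by linarith : s₁ < tₘ)]
    set c1 := (L t₀ t₁ - L t₀ tₘ) - (L s₀ s₁ - L s₀ sₘ) with hc1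
    set c2 := (L tₘ t₁ - L t₀ t₁) - (L sₘ s₁ - L s₀ s₁) with hc2
    set c3 := logVar (fun r => φ r - center φ sₘ tₘ) s₀ s₁ - (L s₁ tₘ - L s₀ tₘ) with hc3
    set c4 := logVar (fun r => φ r - center φ sₘ tₘ) t₀ t₁ - (L sₘ t₁ - L sₘ t₀) with hc4
    refine lt_of_eq_of_lt (congrArg norm (?_ : _ = ((c4 - c3) - (c1 + c2)) +
      ((segLog (φ s₁) (φ t₁) (φ sₘ) - segLog (φ s₀) (φ t₀) (φ sₘ)) +
      (segLog (φ s₁) (φ t₁) (φ tₘ) - segLog (φ s₀) (φ t₀) (φ tₘ))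
      + (segLog (φ s₀) (φ t₀) (center φ sₘ tₘ) - segLog (φ s₁) (φ t₁) (center φ sₘ tₘ))))) ?_
    · rw [hc1, hc2, hc3, hc4]; ring
    · have n1 := norm_sub_le c4 c3
      have n2 := norm_add_le c1 c2
      have n3 := norm_sub_le (segLog (φ s₁) (φ t₁) (φ sₘ)) (segLog (φ s₀) (φ t₀) (φ sₘ))
      have n4 := norm_sub_le (segLog (φ s₁) (φ t₁) (φ tₘ)) (segLog (φ s₀) (φ t₀) (φ tₘ))
      have n5 := norm_sub_le (segLog (φ s₀) (φ t₀) (center φ sₘ tₘ))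
        (segLog (φ s₁) (φ t₁) (center φ sₘ tₘ))
      refine (norm_add_le _ _).trans_lt ?_
      refine (add_le_add (norm_sub_le _ _) (norm_add₃_le)).trans_lt ?_
      linarith

/-- The rim of the ladder winds around the center. -/
theorem ladderVar_center_ne_zero (h : IsConfig φ e t s₀ sₘ s₁ t₀ tₘ t₁ η) {L : ℝ → ℝ → ℂ}
    (hLc : ∀ x y, x < y → ContinuousAt (Function.uncurry L) (x, y))
    (hL : ∀ x y, 0 ≤ x → x < y → Complex.exp (L x y) = φ y - φ x) :
    ladderVar φ s₀ s₁ t₀ t₁ (center φ sₘ tₘ) ≠ 0 := by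
  intro hzero
  have hη := h.pos
  have o0 := h.lad.nonneg
  have o1 := h.s0m
  have o2 := h.sm1
  have o3 := h.lad.lt_st
  have o4 := h.t0m
  have o5 := h.tm1
  have E1 := logVar_eq_of_gt hLc hL (x := s₀) (y := s₁) (u := tₘ) o0 (by linarith) (by linarith)
  have E2 := logVar_eq_of_lt hLc hL (x := t₀) (y := t₁) (u := sₘ) (by linarith) (by linarith)
    (by linarith)
  have E3 := logVar_eq_of_lt hLc hL (x := sₘ) (y := s₁) (u := s₀) o2.le o0 o1
  have E4 := logVar_eq_of_gt hLc hL (x := s₀) (y := sₘ) (u := s₁) o0 o1.le o2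
  have E7 := logVar_eq_of_lt hLc hL (x := tₘ) (y := t₁) (u := s₀) o5.le o0 (by linarith)
  have E8 := logVar_eq_of_gt hLc hL (x := s₀) (y := sₘ) (u := t₁) o0 o1.le (by linarith)
  have E9 := logVar_eq_of_gt hLc hL (x := sₘ) (y := s₁) (u := t₀) (by linarith) o2.le (by linarith)
  have E10 := logVar_eq_of_lt hLc hL (x := t₀) (y := tₘ) (u := s₁) o4.le (by linarith) (by linarith)
  have C1 := h.norm_logVar_upper (z := φ s₀) (by simp; positivity)
  have C2 := h.norm_logVar_lower_s
  have C3 := h.norm_logVar_upper_s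
  have C4 := h.norm_logVar_lower (z := φ s₁) (by simp; positivity)
  have C5 := h.norm_logVar_s_center
  have C6 := h.norm_logVar_t_center
  obtain ⟨S5, S6⟩ := h.norm_segLog_near (h.near_center (center_mem φ sₘ tₘ))
  rw [E7, E3] at C1
  rw [E8, E4] at C2
  rw [E9, E3] at C3
  rw [E10, E4] at C4
  rw [E1] at C5
  rw [E2] at C6
  rw [ladderVar] at hzero
  set c1 := (L s₀ t₁ - L s₀ tₘ) - (L s₀ s₁ - L s₀ sₘ) with hc1
  set c2 := (L sₘ t₁ - L s₀ t₁) - (L sₘ s₁ - L s₀ s₁) with hc2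
  set c3 := (L s₁ t₀ - L sₘ t₀) - (L s₀ s₁ - L s₀ sₘ) with hc3
  set c4 := (L s₁ tₘ - L s₁ t₀) - (L sₘ s₁ - L s₀ s₁) with hc4
  set c5 := logVar (fun r => φ r - center φ sₘ tₘ) s₀ s₁ - (L s₁ tₘ - L s₀ tₘ) with hc5
  set c6 := logVar (fun r => φ r - center φ sₘ tₘ) t₀ t₁ - (L sₘ t₁ - L sₘ t₀) with hc6
  set X := L sₘ t₀ - L s₀ tₘ with hX
  have key : 2 * X = (c1 + c2 - (c3 + c4)) + (c6 - c5 +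
      (segLog (φ s₀) (φ t₀) (center φ sₘ tₘ) - segLog (φ s₁) (φ t₁) (center φ sₘ tₘ))) := by
    rw [hc1, hc2, hc3, hc4, hc5, hc6, hX]
    linear_combination hzero
  have hXs : ‖X‖ ≤ 1 / 10 := by
    have n0 : ‖2 * X‖ = 2 * ‖X‖ := by simp
    have n1 := norm_sub_le (c1 + c2) (c3 + c4)
    have n2 := norm_add_le c1 c2
    have n3 := norm_add_le c3 c4
    have n4 := norm_sub_le c6 c5
    have n5 := norm_sub_le (segLog (φ s₀) (φ t₀) (center φ sₘ tₘ))
      (segLog (φ s₁) (φ t₁) (center φ sₘ tₘ))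
    have n6 := norm_add_le (c1 + c2 - (c3 + c4)) (c6 - c5 +
      (segLog (φ s₀) (φ t₀) (center φ sₘ tₘ) - segLog (φ s₁) (φ t₁) (center φ sₘ tₘ)))
    have n7 := norm_add_le (c6 - c5)
      (segLog (φ s₀) (φ t₀) (center φ sₘ tₘ) - segLog (φ s₁) (φ t₁) (center φ sₘ tₘ))
    rw [← key, n0] at n6
    linarith
  have hexp := Complex.norm_exp_sub_one_le (hXs.trans (by norm_num))
  obtain ⟨f0, -, -, -⟩ := h.far_of_near_sm (z := φ tₘ) h.segm
  have hne : φ tₘ - φ s₀ ≠ 0 := fun h0 => by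
    rw [norm_sub_rev, h0, norm_zero] at f0; linarith
  have hXe : Complex.exp X = (φ t₀ - φ sₘ) / (φ tₘ - φ s₀) := by
    rw [hX, Complex.exp_sub, hL _ _ (by linarith) (by linarith), hL _ _ o0 (by linarith)]
  have h1 : Complex.exp X + 1 = ((φ t₀ - φ s₀) + (φ tₘ - φ sₘ)) / (φ tₘ - φ s₀) := by
    rw [hXe]; field_simp; ring
  have h2 : ‖Complex.exp X + 1‖ ≤ 1 / 100 := by
    rw [norm_sub_rev] at f0
    rw [h1, norm_div, div_le_iff₀ (by linarith)]
    have := norm_add_le (φ t₀ - φ s₀) (φ tₘ - φ sₘ)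
    linarith [h.seg0, h.segm]
  have h3 : ‖(2 : ℂ)‖ ≤ ‖Complex.exp X + 1‖ + ‖Complex.exp X - 1‖ := by
    have : (2 : ℂ) = (Complex.exp X + 1) - (Complex.exp X - 1) := by ring
    rw [this]; exact norm_sub_le _ _
  rw [Complex.norm_ofNat] at h3
  linarith

end IsConfig

theorem railVar_eq_logVar_sub {φ : ℝ → ℂ} {L : ℝ → ℝ → ℂ}
    (hLc : ∀ x y, x < y → ContinuousAt (Function.uncurry L) (x, y))
    (hL : ∀ x y, 0 ≤ x → x < y → Complex.exp (L x y) = φ y - φ x)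
    {s t u : ℝ} (hs : 0 ≤ s) (hst : s ≤ t) (hu : 0 ≤ u) (hut : u ∉ Set.Icc s t) :
    railVar φ L s t u = logVar (fun r => φ r - φ u) s t - segLog (φ s) (φ t) (φ u) := by
  rw [railVar, logVar_eq_pairLog hLc hL hs hst hu hut]

namespace IsConfig

variable {φ : ℝ → ℂ} {e t s₀ sₘ s₁ t₀ tₘ t₁ η : ℝ}

theorem exists_radius (h : IsConfig φ e t s₀ sₘ s₁ t₀ tₘ t₁ η) :
    ∃ C : ℝ, ∀ z ∉ ladderRim φ s₀ s₁ t₀ t₁, C ≤ ‖z‖ → ladderVar φ s₀ s₁ t₀ t₁ z = 0 := by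
  obtain ⟨C, hC⟩ :=
    (isCompact_Icc (a := min s₀ (t₀ - t)) (b := max s₁ (t₁ - t))).exists_bound_of_continuousOn
    h.lad.cont.continuousOn
  refine ⟨C + η / 2, fun z _ hz => (h.ladderVar_eq_zero fun r hr => ?_).2⟩
  have h1 := hC r hr
  have h2 := norm_sub_norm_le z (φ r)
  rw [norm_sub_rev] at h2
  linarith

/-- The difference of the rails is nonnegative relative to its value at the center. -/
theorem re_ladderVar_nonneg (h : IsConfig φ e t s₀ sₘ s₁ t₀ tₘ t₁ η) {L : ℝ → ℝ → ℂ}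
    (hLc : ∀ x y, x < y → ContinuousAt (Function.uncurry L) (x, y))
    (hL : ∀ x y, 0 ≤ x → x < y → Complex.exp (L x y) = φ y - φ x) {z : ℂ}
    (hz : z ∉ ladderRim φ s₀ s₁ t₀ t₁) :
    0 ≤ (ladderVar φ s₀ s₁ t₀ t₁ z *
      (starRingEnd ℂ) (ladderVar φ s₀ s₁ t₀ t₁ (center φ sₘ tₘ))).re := by
  by_cases h0 : ladderVar φ s₀ s₁ t₀ t₁ z = 0
  · simp [h0]
  · obtain ⟨C, hC⟩ := h.exists_radius
    rw [h.lad.var_eq_of_ne_zero hC h.center_notMem hz (h.ladderVar_center_ne_zero hLc hL) h0,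
      Complex.mul_conj, Complex.ofReal_re]
    exact Complex.normSq_nonneg _

/-- The comparison of the two rails over a time interval containing neither arc of the ladder. -/
theorem rail_le_rail (h : IsConfig φ e t s₀ sₘ s₁ t₀ tₘ t₁ η) {L : ℝ → ℝ → ℂ}
    (hLc : ∀ x y, x < y → ContinuousAt (Function.uncurry L) (x, y))
    (hL : ∀ x y, 0 ≤ x → x < y → Complex.exp (L x y) = φ y - φ x)
    (hback : ∀ u v, 0 ≤ u → u ≤ v → ‖φ u - φ s₁‖ ≤ η / 1000 → ‖φ v - φ s₀‖ ≤ η / 1000 →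
      ∃ w ∈ Set.Icc u v, ∀ r ∈ Set.Icc 0 e, η ≤ ‖φ w - φ r‖)
    {W₀ W₁ : ℝ → ℝ}
    (hW₀ : ∀ u, W₀ u = (railVar φ L s₀ t₀ u *
      (starRingEnd ℂ) (ladderVar φ s₀ s₁ t₀ t₁ (center φ sₘ tₘ))).re)
    (hW₁ : ∀ u, W₁ u = (railVar φ L s₁ t₁ u *
      (starRingEnd ℂ) (ladderVar φ s₀ s₁ t₀ t₁ (center φ sₘ tₘ))).re)
    {x b : ℝ} (hx0 : 0 ≤ x) (hxb : x ≤ b) (hs : ¬ (x ≤ s₀ ∧ s₁ ≤ b)) (ht : ¬ (x ≤ t₀ ∧ t₁ ≤ b))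
    (hx : W₀ x = W₁ x ∨ ∃ v, φ v ∈ segment ℝ (φ s₁) (φ t₁) ∧ x ≤ v ∧
      ∀ w ∈ Set.Ico x v, φ w ∉ segment ℝ (φ s₀) (φ t₀))
    (hb : W₀ b = W₁ b ∨ ∃ v, φ v ∈ segment ℝ (φ s₀) (φ t₀) ∧ x ≤ v ∧ v ≤ b ∧
      ∀ w ∈ Set.Ioc v b, φ w ∉ segment ℝ (φ s₁) (φ t₁))
    (hx₀ : φ x ∉ segment ℝ (φ s₀) (φ t₀)) (hx₁ : φ x ∉ segment ℝ (φ s₁) (φ t₁))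
    (hb₀ : φ b ∉ segment ℝ (φ s₀) (φ t₀)) (hb₁ : φ b ∉ segment ℝ (φ s₁) (φ t₁)) :
    W₀ x ≤ W₁ b := by
  have hη := h.pos
  have o0 := h.lad.nonneg
  have o1 := h.lad.lt_s
  have o2 := h.lad.lt_st
  have o3 := h.lad.lt_t
  have o4 := h.s1e
  have o5 := h.tt0
  have o6 := h.t1e
  have hc := h.lad.cont
  have hdiff : ∀ u, 0 ≤ u → u ∉ Set.Icc s₀ s₁ → u ∉ Set.Icc t₀ t₁ →
      W₀ u - W₁ u = (ladderVar φ s₀ s₁ t₀ t₁ (φ u) *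
        (starRingEnd ℂ) (ladderVar φ s₀ s₁ t₀ t₁ (center φ sₘ tₘ))).re := by
    intro u hu h1 h2
    rw [hW₀, hW₁, ← Complex.sub_re, ← sub_mul, railVar_sub_railVar hLc hL h.lad hu h1 h2]
  have hcl : ∀ P Q : ℂ, IsClosed {u | φ u ∈ segment ℝ P Q} := fun P Q =>
    (isClosed_segment_complex P Q).preimage hc
  refine alternation (hcl (φ s₀) (φ t₀)) (hcl (φ s₁) (φ t₁))
    (Set.disjoint_left.2 fun u h0 h1 => Set.disjoint_left.1 h.lad.disj h0 h1) ?_ ?_ ?_ ?_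
    hx hxb hb hx₀ hx₁ hb₀ hb₁
  · intro u v hu huv _ hw
    rw [hW₀, hW₀, railVar_eq hc hLc hL o0 (by linarith) (by linarith) huv hw]
  · intro u v hu huv _ hw
    rw [hW₁, hW₁, railVar_eq hc hLc hL (by linarith) (by linarith) (by linarith) huv hw]
  · intro u v hu huv _ hu1 hv0 _
    obtain ⟨w, hw, hfar⟩ := hback u v (by linarith) huv.le
      ((norm_sub_left_le_of_mem_segment hu1).trans h.seg1)
      ((norm_sub_left_le_of_mem_segment hv0).trans h.seg0)
    have hwe : w ∉ Set.Icc 0 e := fun hwe => by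
      have := hfar w hwe
      rw [sub_self, norm_zero] at this
      linarith
    have hwt : w - t ∉ Set.Icc 0 e := fun hwt => by
      have h1 := hfar _ hwt
      have h2 := h.shadow _ hwt
      rw [sub_add_cancel] at h2
      linarith
    have hwu : w ≠ u := by
      rintro rfl
      have h1 := hfar s₁ ⟨by linarith, o4⟩
      have h2 := (norm_sub_left_le_of_mem_segment hu1).trans h.seg1
      linarith
    have hwv : w ≠ v := by
      rintro rfl
      have h1 := hfar s₀ ⟨by linarith, by linarith⟩
      have h2 := (norm_sub_left_le_of_mem_segment hv0).trans h.seg0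
      linarith
    refine ⟨w, ⟨lt_of_le_of_ne hw.1 hwu.symm, lt_of_le_of_ne hw.2 hwv⟩, ?_⟩
    have hz := (h.ladderVar_eq_zero (z := φ w) fun r hr => by
      have := hfar r ⟨(le_min o0 (by linarith)).trans hr.1, hr.2.trans (max_le o4 o6)⟩
      rw [norm_sub_rev] at this
      linarith).2
    have := hdiff w (by linarith [hw.1]) (fun h' => hwe ⟨by linarith [h'.1], by linarith [h'.2]⟩)
      (fun h' => hwt ⟨by linarith [h'.1], by linarith [h'.2]⟩)
    rw [hz, zero_mul, Complex.zero_re] at this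
    linarith
  · intro u v hu huv hv hu0 hv1 hgap
    have hm : (u + v) / 2 ∈ Set.Ioo u v := ⟨by linarith, by linarith⟩
    refine ⟨(u + v) / 2, hm, ?_⟩
    generalize (u + v) / 2 = w at hm
    have key : ∀ p q, (φ p ∈ segment ℝ (φ s₀) (φ t₀)) → (φ q ∈ segment ℝ (φ s₁) (φ t₁)) →
        (∀ r ∈ Set.Icc p q, φ r ∈ segment ℝ (φ s₀) (φ t₀) → r = p) →
        (∀ r ∈ Set.Icc p q, φ r ∈ segment ℝ (φ s₁) (φ t₁) → r = q) →
        ¬ (x ≤ p ∧ q ≤ b) → w ∉ Set.Icc p q := by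
      intro p q hp hq h0 h1 hn hw
      have hpu : p ≤ u := by
        by_contra! hlt
        exact (hgap p ⟨hlt, hw.1.trans_lt hm.2⟩).1 hp
      have hqv : v ≤ q := by
        by_contra! hlt
        exact (hgap q ⟨hm.1.trans_le hw.2, hlt⟩).2 hq
      have e1 := h0 u ⟨hpu, by linarith⟩ hu0
      have e2 := h1 v ⟨by linarith, hqv⟩ hv1
      subst e1 e2
      exact hn ⟨hu, hv⟩
    have ws := key s₀ s₁ (left_mem_segment ..) (left_mem_segment ..) h.lad.h₀s h.lad.h₁s hs
    have wt := key t₀ t₁ (right_mem_segment ..) (right_mem_segment ..) h.lad.h₀t h.lad.h₁t ht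
    have hw0 : 0 ≤ w := by linarith [hm.1]
    have himg : ∀ p q, 0 ≤ p → w ∉ Set.Icc p q → φ w ∉ φ '' Set.Icc p q := by
      rintro p q hp hn ⟨r, hr, hre⟩
      have := h.lad.inj (Set.mem_Ici.2 (hp.trans hr.1)) (Set.mem_Ici.2 hw0) hre
      subst this
      exact hn hr
    have hrim : φ w ∉ ladderRim φ s₀ s₁ t₀ t₁ := IsLadder.notMem_rim_iff.2
      ⟨himg _ _ o0 ws, himg _ _ (by linarith) wt, (hgap w hm).1, (hgap w hm).2⟩
    have := h.re_ladderVar_nonneg hLc hL hrim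
    rw [← hdiff w hw0 ws wt] at this
    linarith

/-- A configuration on a recurrent injective curve contradicts the absence of returns from the end
of the arc to its start inside a neighborhood of the arc. -/
theorem false_of_no_return (h : IsConfig φ e t s₀ sₘ s₁ t₀ tₘ t₁ η)
    (hback : ∀ u v, 0 ≤ u → u ≤ v → ‖φ u - φ s₁‖ ≤ η / 1000 → ‖φ v - φ s₀‖ ≤ η / 1000 →
      ∃ w ∈ Set.Icc u v, ∀ r ∈ Set.Icc 0 e, η ≤ ‖φ w - φ r‖)
    (hfar : ∀ r ∈ Set.Icc (min s₀ (t₀ - t)) (max s₁ (t₁ - t)), η ≤ ‖φ r - φ 0‖)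
    (hrec : ∀ ε > 0, ∀ T, ∃ u ≥ T, ‖φ u - φ 0‖ ≤ ε) : False := by
  obtain ⟨L, hLc, hL⟩ := exists_log_difference h.lad.cont h.lad.inj
  have hη := h.pos
  have o0 := h.lad.nonneg
  have o1 := h.s0m
  have o2 := h.sm1
  have o3 := h.lad.lt_st
  have o4 := h.t0m
  have o5 := h.tm1
  have hc := h.lad.cont
  have hs0 : s₀ ≠ 0 := by
    rintro rfl
    have := hfar 0 ⟨min_le_left _ _, (by linarith : (0 : ℝ) ≤ s₁).trans (le_max_left _ _)⟩
    rw [sub_self, norm_zero] at this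
    linarith
  have hs0' : 0 < s₀ := lt_of_le_of_ne o0 hs0.symm
  obtain ⟨hrim0, hvar0⟩ := h.ladderVar_eq_zero (z := φ 0) fun r hr => by linarith [hfar r hr]
  obtain ⟨z1, z2, z3, z4⟩ := IsLadder.notMem_rim_iff.1 hrim0
  have h0n : φ 0 ∉ φ '' Set.Icc s₀ t₀ := by
    rintro ⟨r, hr, hre⟩
    have := h.lad.inj (Set.mem_Ici.2 (o0.trans hr.1)) (Set.mem_Ici.2 le_rfl) hre
    linarith [hr.1]
  have hcont : ContinuousAt (fun z => logVar (fun r => φ r - z) s₀ t₀ - segLog (φ s₀) (φ t₀) z)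
      (φ 0) :=
    (continuousAt_logVar_sub (by linarith) hc.continuousOn h0n).sub (continuousAt_segLog z3)
  obtain ⟨δ, hδ, hδ'⟩ := Metric.continuousAt_iff.1 hcont 6 (by norm_num)
  obtain ⟨T, hT, hTδ⟩ := hrec (min (δ / 2) (η / 2)) (by positivity) (t₁ + 1)
  have hTt : t₁ < T := by linarith
  obtain ⟨hrimT, hvarT⟩ := h.ladderVar_eq_zero (z := φ T) fun r hr => by
    have h1 := hfar r hr
    have h2 := hTδ.trans (min_le_right _ _)
    have h3 := norm_sub_le_norm_sub_add_norm_sub (φ r) (φ T) (φ 0)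
    linarith
  obtain ⟨y1, y2, y3, y4⟩ := IsLadder.notMem_rim_iff.1 hrimT
  have hWT : railVar φ L s₀ t₀ T = railVar φ L s₀ t₀ 0 := by
    have hclose := hδ' (x := φ T) (by
      rw [dist_eq_norm]; linarith [hTδ.trans (min_le_left _ _)])
    rw [dist_eq_norm, ← railVar_eq_logVar_sub hLc hL o0 (by linarith) (by linarith)
      (fun h' => by linarith [h'.2]), ← railVar_eq_logVar_sub hLc hL o0 (by linarith) le_rfl
      (fun h' => by linarith [h'.1])] at hclose
    refine sub_eq_zero.1 (eq_zero_of_exp_eq_one_of_norm_lt ?_ hclose)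
    rw [Complex.exp_sub, exp_railVar hL o0 (by linarith) (by linarith) y3,
      exp_railVar hL o0 (by linarith) le_rfl z3, div_one]
  have hD0 := railVar_sub_railVar hLc hL h.lad (le_refl (0 : ℝ)) (fun h' => by linarith [h'.1])
    (fun h' => by linarith [h'.1])
  have hDT := railVar_sub_railVar hLc hL h.lad (u := T) (by linarith) (fun h' => by linarith [h'.2])
    (fun h' => by linarith [h'.2])
  rw [hvar0] at hD0
  rw [hvarT] at hDT
  have hjump := h.jump_add_jump hLc hL
  have hν := h.ladderVar_center_ne_zero hLc hL
  obtain ⟨m1, m2⟩ := h.notMem_of_near_sm (z := φ sₘ) (by simp; positivity)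
  obtain ⟨m3, m4⟩ := h.notMem_of_near_sm (z := φ tₘ) h.segm
  have I1 := h.rail_le_rail hLc hL hback (fun _ => rfl) (fun _ => rfl) (x := 0) (b := sₘ) le_rfl
    (by linarith) (fun h' => by linarith [h'.2]) (fun h' => by linarith [h'.2])
    (Or.inl (by rw [sub_eq_zero.1 hD0]))
    (Or.inr ⟨s₀, left_mem_segment .., o0, o1.le, fun w hw hw' => by
      have := h.lad.h₁s w ⟨hw.1.le, by linarith [hw.2]⟩ hw'
      linarith [hw.2]⟩) z3 z4 m1 m2
  have I2 := h.rail_le_rail hLc hL hback (fun _ => rfl) (fun _ => rfl) (x := sₘ) (b := tₘ)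
    (by linarith) (by linarith) (fun h' => by linarith [h'.1]) (fun h' => by linarith [h'.2])
    (Or.inr ⟨s₁, left_mem_segment .., o2.le, fun w hw hw' => by
      have := h.lad.h₀s w ⟨by linarith [hw.1], hw.2.le⟩ hw'
      linarith [hw.1]⟩)
    (Or.inr ⟨t₀, right_mem_segment .., by linarith, o4.le, fun w hw hw' => by
      have := h.lad.h₁t w ⟨hw.1.le, by linarith [hw.2]⟩ hw'
      linarith [hw.2]⟩) m1 m2 m3 m4
  have I3 := h.rail_le_rail hLc hL hback (fun _ => rfl) (fun _ => rfl) (x := tₘ) (b := T)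
    (by linarith) (by linarith) (fun h' => by linarith [h'.1]) (fun h' => by linarith [h'.1])
    (Or.inr ⟨t₁, right_mem_segment .., o5.le, fun w hw hw' => by
      have := h.lad.h₀t w ⟨by linarith [hw.1], hw.2.le⟩ hw'
      linarith [hw.1]⟩)
    (Or.inl (by rw [sub_eq_zero.1 hDT])) m3 m4 y3 y4
  rw [← sub_eq_zero.1 hDT, hWT] at I3
  have hpos : 0 < (ladderVar φ s₀ s₁ t₀ t₁ (center φ sₘ tₘ) *
      (starRingEnd ℂ) (ladderVar φ s₀ s₁ t₀ t₁ (center φ sₘ tₘ))).re := by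
    rw [Complex.mul_conj, Complex.ofReal_re]
    exact Complex.normSq_pos.2 hν
  nth_rewrite 1 [← hjump] at hpos
  simp only [add_mul, sub_mul, Complex.add_re, Complex.sub_re] at hpos
  linarith

end IsConfig

theorem exists_pos_le_norm_sub_of_injOn {φ : ℝ → ℂ} (hφ : Continuous φ)
    (hinj : Set.InjOn φ (Set.Ici 0)) (e : ℝ) {γ : ℝ} (hγ : 0 < γ) :
    ∃ m > 0, ∀ x ∈ Set.Icc 0 e, ∀ y ∈ Set.Icc 0 e, γ ≤ |x - y| → m ≤ ‖φ x - φ y‖ := by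
  have hK : IsCompact ((Set.Icc 0 e ×ˢ Set.Icc 0 e) ∩ {p : ℝ × ℝ | γ ≤ |p.1 - p.2|}) :=
    (isCompact_Icc.prod isCompact_Icc).inter_right (isClosed_le (by fun_prop) (by fun_prop))
  obtain hne | hne :=
    ((Set.Icc 0 e ×ˢ Set.Icc 0 e) ∩ {p : ℝ × ℝ | γ ≤ |p.1 - p.2|}).eq_empty_or_nonempty
  · refine ⟨1, one_pos, fun x hx y hy hxy => ?_⟩
    have : (x, y) ∈ ((Set.Icc 0 e ×ˢ Set.Icc 0 e) ∩ {p : ℝ × ℝ | γ ≤ |p.1 - p.2|}) :=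
      ⟨⟨hx, hy⟩, hxy⟩
    rw [hne] at this
    exact this.elim
  · obtain ⟨p, hp, hmin⟩ := hK.exists_isMinOn hne
      (f := fun p : ℝ × ℝ => ‖φ p.1 - φ p.2‖) (by fun_prop)
    refine ⟨‖φ p.1 - φ p.2‖, norm_pos_iff.2 (sub_ne_zero.2 fun heq => ?_),
      fun x hx y hy hxy => isMinOn_iff.1 hmin (x, y) ⟨⟨hx, hy⟩, hxy⟩⟩
    have h1 := hinj hp.1.1.1 hp.1.2.1 heq
    have h2 : γ ≤ |p.1 - p.2| := hp.2
    rw [h1, sub_self, abs_zero] at h2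
    linarith

theorem exists_modulus {φ : ℝ → ℂ} (hφ : Continuous φ) (e : ℝ) {ε : ℝ} (hε : 0 < ε) :
    ∃ κ > 0, ∀ x ∈ Set.Icc 0 e, ∀ y ∈ Set.Icc 0 e, |x - y| ≤ κ → ‖φ x - φ y‖ ≤ ε := by
  obtain ⟨δ, hδ, h⟩ := Metric.uniformContinuousOn_iff.1
    (isCompact_Icc.uniformContinuousOn_of_continuous (hφ.continuousOn (s := Set.Icc 0 e))) ε hε
  refine ⟨δ / 2, half_pos hδ, fun x hx y hy hxy => ?_⟩
  have := h x hx y hy (by rw [Real.dist_eq]; linarith)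
  rw [dist_eq_norm] at this
  exact this.le

/-- A short segment joining an injective arc to a shadowing later arc, and meeting both of them only
at its ends. -/
theorem exists_rung {φ : ℝ → ℂ} (hφ : Continuous φ) (hinj : Set.InjOn φ (Set.Ici 0))
    {e t ε κ m a : ℝ} (ht : 0 ≤ t)
    (hsh : ∀ r ∈ Set.Icc 0 e, ‖φ (r + t) - φ r‖ ≤ ε) (hεm : 2 * ε < m)
    (hsep : ∀ x ∈ Set.Icc 0 e, ∀ y ∈ Set.Icc 0 e, κ ≤ |x - y| → m ≤ ‖φ x - φ y‖)
    (ha : a ∈ Set.Icc 0 e) :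
    ∃ s τ, s ∈ Set.Icc 0 e ∧ τ ∈ Set.Icc t (t + e) ∧ |s - a| < κ ∧ |τ - t - a| < κ ∧
      ‖φ τ - φ s‖ ≤ 2 * ε ∧
      (∀ r ∈ Set.Icc 0 e, φ r ∈ segment ℝ (φ s) (φ τ) → r = s) ∧
      (∀ r ∈ Set.Icc t (t + e), φ r ∈ segment ℝ (φ s) (φ τ) → r = τ) := by
  have hε : 0 ≤ ε := (norm_nonneg _).trans (hsh a ha)
  obtain ⟨_, ⟨s, hs, rfl⟩, _, ⟨τ, hτ, rfl⟩, h1, h2, h3, h4⟩ := exists_clean_segment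
    (isCompact_Icc.image hφ).isClosed (isCompact_Icc.image hφ).isClosed
    (Set.mem_image_of_mem φ ha)
    (Set.mem_image_of_mem φ (⟨by linarith [ha.1], by linarith [ha.2]⟩ : a + t ∈ Set.Icc t (t + e)))
  have n1 := (norm_sub_left_le_of_mem_segment h1).trans (hsh a ha)
  have n2 := (norm_sub_left_le_of_mem_segment h2).trans (hsh a ha)
  have hτ' : τ - t ∈ Set.Icc 0 e := ⟨by linarith [hτ.1], by linarith [hτ.2]⟩
  have n3 := hsh _ hτ'
  rw [sub_add_cancel, norm_sub_rev] at n3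
  refine ⟨s, τ, hs, hτ, ?_, ?_, ?_, ?_, ?_⟩
  · by_contra! hlt
    have := hsep s hs a ha hlt
    linarith
  · by_contra! hlt
    have := hsep _ hτ' a ha hlt
    have := norm_sub_le_norm_sub_add_norm_sub (φ (τ - t)) (φ τ) (φ a)
    linarith
  · have := norm_sub_le_norm_sub_add_norm_sub (φ τ) (φ a) (φ s)
    rw [norm_sub_rev (φ a)] at this
    linarith
  · exact fun r hr hr' => hinj hr.1 hs.1 (h3 _ hr' ⟨r, hr, rfl⟩)
  · exact fun r hr hr' => hinj (ht.trans hr.1) (ht.trans hτ.1) (h4 _ hr' ⟨r, hr, rfl⟩)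

/-- A recurrent injective curve in the plane returns from near a later point of an initial arc to
near an earlier one while remaining near the arc. -/
theorem exists_return {φ : ℝ → ℂ} (hφ : Continuous φ) (hinj : Set.InjOn φ (Set.Ici 0))
    {e a₀ a₁ η : ℝ} (ha₀ : 0 < a₀) (ha : a₀ < a₁) (hae : a₁ < e) (hη : 0 < η)
    (hrec : ∀ ε > 0, ∀ T, ∃ t ≥ T, ∀ r ∈ Set.Icc 0 e, ‖φ (r + t) - φ r‖ ≤ ε) :
    ∃ u v, 0 ≤ u ∧ u ≤ v ∧ ‖φ u - φ a₁‖ < η ∧ ‖φ v - φ a₀‖ < η ∧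
      ∀ w ∈ Set.Icc u v, ∃ r ∈ Set.Icc 0 e, ‖φ w - φ r‖ < η := by
  by_contra! hno
  obtain ⟨γ, hγ, hγ1, hγ2⟩ : ∃ γ > 0, 4 * γ ≤ a₁ - a₀ ∧ 2 * γ ≤ a₀ :=
    ⟨min ((a₁ - a₀) / 4) (a₀ / 2), lt_min (by linarith) (by linarith),
      by linarith [min_le_left ((a₁ - a₀) / 4) (a₀ / 2)],
      by linarith [min_le_right ((a₁ - a₀) / 4) (a₀ / 2)]⟩
  obtain ⟨m, hm, hsepm⟩ := exists_pos_le_norm_sub_of_injOn hφ hinj e hγ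
  obtain ⟨ξ, hξ, hξη, hξm⟩ : ∃ ξ > 0, ξ ≤ η ∧ ξ ≤ m :=
    ⟨min η m, lt_min hη hm, min_le_left _ _, min_le_right _ _⟩
  obtain ⟨κ₀, hκ₀, hmod⟩ := exists_modulus hφ e (ε := ξ / 1000) (by positivity)
  obtain ⟨κ, hκ, hκ1, hκ2, hκ3⟩ : ∃ κ > 0, 2 * κ ≤ κ₀ ∧ 2 * κ ≤ γ ∧ κ ≤ e - a₁ := by
    refine ⟨min (min (κ₀ / 2) (γ / 2)) (e - a₁),
      lt_min (lt_min (by positivity) (by positivity)) (by linarith), ?_, ?_, min_le_right _ _⟩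
    · linarith [min_le_left (min (κ₀ / 2) (γ / 2)) (e - a₁), min_le_left (κ₀ / 2) (γ / 2)]
    · linarith [min_le_left (min (κ₀ / 2) (γ / 2)) (e - a₁), min_le_right (κ₀ / 2) (γ / 2)]
  obtain ⟨m', hm', hsep⟩ := exists_pos_le_norm_sub_of_injOn hφ hinj e hκ
  obtain ⟨ε, hε, hε1, hε2⟩ : ∃ ε > 0, ε ≤ ξ / 2000 ∧ 2 * ε < m' :=
    ⟨min (ξ / 2000) (m' / 4), lt_min (by positivity) (by positivity), min_le_left _ _,
      by linarith [min_le_right (ξ / 2000) (m' / 4)]⟩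
  obtain ⟨t, ht, hsh⟩ := hrec ε hε (e + 1)
  have ht0 : 0 ≤ t := by linarith
  obtain ⟨s₀, t₀, hs₀, ht₀, hsa₀, hta₀, hseg₀, hcs₀, hct₀⟩ :=
    exists_rung hφ hinj ht0 hsh hε2 hsep (a := a₀) ⟨by linarith, by linarith⟩
  obtain ⟨sₘ, tₘ, hsₘ, htₘ, hsaₘ, htaₘ, hsegₘ, hcsₘ, hctₘ⟩ :=
    exists_rung hφ hinj ht0 hsh hε2 hsep (a := (a₀ + a₁) / 2) ⟨by linarith, by linarith⟩
  obtain ⟨s₁, t₁, hs₁, ht₁, hsa₁, hta₁, hseg₁, hcs₁, hct₁⟩ :=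
    exists_rung hφ hinj ht0 hsh hε2 hsep (a := a₁) ⟨by linarith, by linarith⟩
  have hnear : ∀ {s τ a : ℝ}, s ∈ Set.Icc 0 e → τ ∈ Set.Icc t (t + e) → |s - a| < κ →
      |τ - t - a| < κ → ∀ r ∈ Set.uIcc s (τ - t), ‖φ r - φ s‖ ≤ ξ / 1000 := by
    intro s τ a hs hτ h1 h2 r hr
    have hτ' : τ - t ∈ Set.Icc 0 e := ⟨by linarith [hτ.1], by linarith [hτ.2]⟩
    refine hmod r (Set.uIcc_subset_Icc hs hτ' hr) s hs ?_
    have h3 := Set.abs_sub_left_of_mem_uIcc hr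
    have h4 := abs_sub_le (τ - t) a s
    rw [abs_sub_comm a s] at h4
    linarith
  rw [abs_lt] at hsa₀ hta₀ hsaₘ htaₘ hsa₁ hta₁
  have hfar₀ : ∀ r ∈ Set.Icc (min s₀ (t₀ - t)) e, ξ ≤ ‖φ r - φ 0‖ := by
    intro r hr
    have h1 : a₀ - κ ≤ r := (le_min (by linarith) (by linarith)).trans hr.1
    exact hξm.trans (hsepm r ⟨by linarith, hr.2⟩ 0 ⟨le_rfl, by linarith⟩
      (by rw [sub_zero]; exact le_trans (by linarith) (le_abs_self r)))
  have hsep0 : ∀ r ∈ Set.Icc (min sₘ (tₘ - t)) e, ξ ≤ ‖φ r - φ s₀‖ := by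
    intro r hr
    have h1 : (a₀ + a₁) / 2 - κ ≤ r := (le_min (by linarith) (by linarith)).trans hr.1
    exact hξm.trans (hsepm r ⟨by linarith, hr.2⟩ s₀ hs₀ (le_trans (by linarith) (le_abs_self _)))
  have hsep1 : ∀ r ∈ Set.Icc 0 (max sₘ (tₘ - t)), ξ ≤ ‖φ r - φ s₁‖ := by
    intro r hr
    have h1 : r ≤ (a₀ + a₁) / 2 + κ := hr.2.trans (max_le (by linarith) (by linarith))
    rw [norm_sub_rev]
    exact hξm.trans (hsepm s₁ hs₁ r ⟨hr.1, by linarith⟩ (le_trans (by linarith) (le_abs_self _)))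
  have hmax : max s₁ (t₁ - t) ≤ e := max_le hs₁.2 (by linarith [ht₁.2])
  have hmin : 0 ≤ min s₀ (t₀ - t) := le_min hs₀.1 (by linarith [ht₀.1])
  have hlad : IsLadder φ s₀ s₁ t₀ t₁ :=
    { cont := hφ
      inj := hinj
      nonneg := hs₀.1
      lt_s := by linarith
      lt_st := by linarith [hs₁.2, ht₀.1]
      lt_t := by linarith
      disj := by
        refine Set.disjoint_left.2 fun w hw0 hw1 => ?_
        have h1 := (norm_sub_left_le_of_mem_segment hw0).trans hseg₀
        have h2 := (norm_sub_left_le_of_mem_segment hw1).trans hseg₁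
        have h3 := hsep0 s₁ ⟨(min_le_left _ _).trans (by linarith), hs₁.2⟩
        have h4 := norm_sub_le_norm_sub_add_norm_sub (φ s₁) w (φ s₀)
        rw [norm_sub_rev (φ s₁) w] at h4
        linarith
      h₀s := fun r hr => hcs₀ r ⟨hs₀.1.trans hr.1, hr.2.trans hs₁.2⟩
      h₁s := fun r hr => hcs₁ r ⟨hs₀.1.trans hr.1, hr.2.trans hs₁.2⟩
      h₀t := fun r hr => hct₀ r ⟨ht₀.1.trans hr.1, hr.2.trans ht₁.2⟩
      h₁t := fun r hr => hct₁ r ⟨ht₀.1.trans hr.1, hr.2.trans ht₁.2⟩ }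
  have hcfg : IsConfig φ e t s₀ sₘ s₁ t₀ tₘ t₁ ξ :=
    { lad := hlad
      pos := hξ
      s0m := by linarith
      sm1 := by linarith
      t0m := by linarith
      tm1 := by linarith
      s1e := hs₁.2
      tt0 := ht₀.1
      t1e := by linarith [ht₁.2]
      shadow := fun r hr => (hsh r hr).trans (by linarith)
      near0 := hnear hs₀ ht₀ (abs_lt.2 hsa₀) (abs_lt.2 hta₀)
      nearm := hnear hsₘ htₘ (abs_lt.2 hsaₘ) (abs_lt.2 htaₘ)
      near1 := hnear hs₁ ht₁ (abs_lt.2 hsa₁) (abs_lt.2 hta₁)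
      seg0 := by linarith
      segm := by linarith
      seg1 := by linarith
      sep0 := fun r hr => hsep0 r ⟨hr.1, hr.2.trans hmax⟩
      sep1 := fun r hr => hsep1 r ⟨hmin.trans hr.1, hr.2⟩
      clean_s := fun r hr => hcsₘ r ⟨hs₀.1.trans hr.1, hr.2.trans hs₁.2⟩
      clean_t := fun r hr => hctₘ r ⟨ht₀.1.trans hr.1, hr.2.trans ht₁.2⟩ }
  refine hcfg.false_of_no_return (fun u v hu huv h1 h0 => ?_)
    (fun r hr => hfar₀ r ⟨hr.1, hr.2.trans hmax⟩) fun ε hε T => ?_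
  · have hd : ∀ {s a : ℝ}, s ∈ Set.Icc 0 e → a ∈ Set.Icc 0 e → |s - a| < κ →
        ‖φ s - φ a‖ ≤ ξ / 1000 := fun hs ha h => hmod _ hs _ ha (by linarith)
    have d0 := hd hs₀ (a := a₀) ⟨by linarith, by linarith⟩ (abs_lt.2 hsa₀)
    have d1 := hd hs₁ (a := a₁) ⟨by linarith, by linarith⟩ (abs_lt.2 hsa₁)
    have e0 := norm_sub_le_norm_sub_add_norm_sub (φ v) (φ s₀) (φ a₀)
    have e1 := norm_sub_le_norm_sub_add_norm_sub (φ u) (φ s₁) (φ a₁)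
    obtain ⟨w, hw, hw'⟩ := hno u v hu huv (by linarith) (by linarith)
    exact ⟨w, hw, fun r hr => hξη.trans (hw' r hr)⟩
  · obtain ⟨u, hu, hu'⟩ := hrec ε hε T
    refine ⟨u, hu, ?_⟩
    have := hu' 0 ⟨le_rfl, by linarith⟩
    rwa [zero_add] at this

section BebutovDynamics

variable {Z : Type*} [MetricSpace Z] {X : Set C(ℝ≥0, Z)}

@[simp]
theorem bebShift_apply (τ : ℝ≥0) (φ : C(ℝ≥0, Z)) (t : ℝ≥0) : bebShift τ φ t = φ (t + τ) := rfl

theorem continuous_bebShift (τ : ℝ≥0) :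
    Continuous (bebShift τ : C(ℝ≥0, Z) → C(ℝ≥0, Z)) :=
  ContinuousMap.continuous_precomp _

theorem bebShift_bebShift (σ τ : ℝ≥0) (φ : C(ℝ≥0, Z)) :
    bebShift σ (bebShift τ φ) = bebShift (σ + τ) φ := by
  ext t
  simp [add_assoc]

/-- The elements of a Bebutov shift that extend arbitrarily far into the past. -/
def bebCore (X : Set C(ℝ≥0, Z)) : Set C(ℝ≥0, Z) := ⋂ c : ℝ≥0, bebShift c '' X

theorem mem_bebCore {ψ : C(ℝ≥0, Z)} : ψ ∈ bebCore X ↔ ∀ c, ∃ ψ' ∈ X, bebShift c ψ' = ψ := by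
  simp [bebCore]

theorem bebCore_subset : bebCore X ⊆ X := fun ψ hψ => by
  obtain ⟨ψ', h, rfl⟩ := mem_bebCore.1 hψ 0
  convert h
  ext t
  simp

namespace IsSwitchedBebutovShift

theorem isCompact_bebCore (hX : IsSwitchedBebutovShift X) : IsCompact (bebCore X) :=
  hX.1.of_isClosed_subset
    (isClosed_iInter fun c => (hX.1.image (continuous_bebShift c)).isClosed) bebCore_subset

theorem bebShift_mem_bebCore (hX : IsSwitchedBebutovShift X) {ψ : C(ℝ≥0, Z)} (hψ : ψ ∈ bebCore X)
    (τ : ℝ≥0) : bebShift τ ψ ∈ bebCore X := by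
  refine mem_bebCore.2 fun c => ?_
  obtain ⟨ψ', h, rfl⟩ := mem_bebCore.1 hψ c
  exact ⟨bebShift τ ψ', hX.2.1 _ h _, by rw [bebShift_bebShift, bebShift_bebShift, add_comm]⟩

theorem mem_bebCore_of_recurrent (hX : IsSwitchedBebutovShift X) {φ : C(ℝ≥0, Z)} (hφ : φ ∈ X)
    (hrec : IsShiftRecurrent φ) : φ ∈ bebCore X := by
  obtain ⟨t, ht, htφ⟩ := hrec
  refine Set.mem_iInter.2 fun c =>
    (hX.1.image (continuous_bebShift c)).isClosed.mem_of_tendsto htφ ?_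
  filter_upwards [ht.eventually_ge_atTop c] with n hn
  exact ⟨bebShift (t n - c) φ, hX.2.1 _ hφ _, by
    rw [bebShift_bebShift, add_tsub_cancel_of_le hn]⟩

/-- Elements of the core may be concatenated wherever they meet. -/
theorem exists_concat (hX : IsSwitchedBebutovShift X) {ψ₁ ψ₂ : C(ℝ≥0, Z)} (h₁ : ψ₁ ∈ bebCore X)
    (h₂ : ψ₂ ∈ bebCore X) {τ₁ τ₂ : ℝ≥0} (h : ψ₁ τ₁ = ψ₂ τ₂) :
    ∃ χ ∈ bebCore X, (∀ t ≤ τ₁, χ t = ψ₁ t) ∧ ∀ t, χ (τ₁ + t) = ψ₂ (τ₂ + t) := by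
  classical
  have hcont : Continuous fun t : ℝ≥0 => if t ≤ τ₁ then ψ₁ t else ψ₂ (τ₂ + (t - τ₁)) :=
    Continuous.if_le (by fun_prop) (by fun_prop) continuous_id continuous_const
      fun t ht => by subst ht; simpa using h
  refine ⟨⟨_, hcont⟩, ?_, fun t ht => if_pos ht, fun t => ?_⟩
  · refine mem_bebCore.2 fun c => ?_
    obtain ⟨ψ₁', m₁, rfl⟩ := mem_bebCore.1 h₁ (c + 1 + τ₂)
    obtain ⟨ψ₂', m₂, rfl⟩ := mem_bebCore.1 h₂ (c + 1 + τ₁)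
    have hpos : 0 < τ₁ + (c + 1 + τ₂) := by positivity
    have hmeet : ψ₁' (τ₁ + (c + 1 + τ₂)) = ψ₂' (τ₁ + (c + 1 + τ₂)) := by
      rw [bebShift_apply, bebShift_apply] at h
      rw [h]
      congr 1
      ring
    have hc' : Continuous fun t : ℝ≥0 => if t ≤ τ₁ + (c + 1 + τ₂) then ψ₁' t else ψ₂' t :=
      Continuous.if_le (by fun_prop) (by fun_prop) continuous_id continuous_const
        fun t ht => by subst ht; exact hmeet
    have hmem := hX.2.2 _ m₁ _ m₂ _ hpos hmeet ⟨_, hc'⟩ (fun t ht => if_pos ht) fun t ht => by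
      rcases ht.eq_or_lt with rfl | hlt
      · exact (if_pos le_rfl).trans hmeet
      · exact if_neg hlt.not_ge
    refine ⟨_, hX.2.1 _ hmem (1 + τ₂), ?_⟩
    rw [bebShift_bebShift]
    ext t
    have hsum : c + (1 + τ₂) = c + 1 + τ₂ := by ring
    simp only [bebShift_apply, ContinuousMap.coe_mk, hsum, add_le_add_iff_right]
    split_ifs with ht
    · rfl
    · congr 1
      obtain ⟨d, rfl⟩ := exists_add_of_le (not_le.1 ht).le
      rw [add_tsub_cancel_left]
      ring
  · simp only [ContinuousMap.coe_mk]
    split_ifs with ht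
    · have : t = 0 := by simpa using ht
      subst this
      simpa using h
    · rw [add_tsub_cancel_left]

/-- A closed piece of an element of the core may be repeated indefinitely. -/
theorem exists_periodic (hX : IsSwitchedBebutovShift X) {ψ : C(ℝ≥0, Z)} (hψ : ψ ∈ bebCore X)
    {d : ℝ≥0} (hd : 0 < d) (h : ψ d = ψ 0) :
    ∃ χ ∈ bebCore X, (∀ t, χ (t + d) = χ t) ∧ χ 0 = ψ 0 ∧ ∀ t, ∃ s ≤ d, χ t = ψ s := by
  have hstep : ∀ χ : {χ // χ ∈ bebCore X ∧ χ 0 = ψ 0}, ∃ χ' : {χ // χ ∈ bebCore X ∧ χ 0 = ψ 0},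
      (∀ t ≤ d, χ'.1 t = ψ t) ∧ ∀ t, χ'.1 (d + t) = χ.1 t := by
    rintro ⟨χ, hχ, hχ0⟩
    obtain ⟨χ', m, h1, h2⟩ := hX.exists_concat hψ hχ (τ₁ := d) (τ₂ := 0) (h.trans hχ0.symm)
    exact ⟨⟨χ', m, h1 0 zero_le⟩, h1, fun t => by simpa using h2 t⟩
  choose F hF1 hF2 using hstep
  let u : ℕ → {χ // χ ∈ bebCore X ∧ χ 0 = ψ 0} := fun n => F^[n] ⟨ψ, hψ, rfl⟩
  have hu : ∀ n, u (n + 1) = F (u n) := fun n => Function.iterate_succ_apply' F n _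
  have hstab : ∀ n : ℕ, ∀ t : ℝ≥0, t ≤ n * d → (u (n + 1)).1 t = (u n).1 t := by
    intro n
    induction n with
    | zero =>
      intro t ht
      have : t = 0 := by simpa using ht
      subst this
      exact (u 1).2.2.trans (u 0).2.2.symm
    | succ n ih =>
      intro t ht
      rcases le_total t d with htd | htd
      · rw [hu (n + 1), hF1 _ t htd, hu n, hF1 _ t htd]
      · obtain ⟨s, rfl⟩ := exists_add_of_le htd
        rw [hu (n + 1), hF2, ih s ?_, hu n, hF2]
        push_cast at ht
        rw [add_mul, one_mul, add_comm] at ht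
        exact le_of_add_le_add_right ht
  have hstab' : ∀ n k : ℕ, ∀ t : ℝ≥0, t ≤ n * d → (u (n + k)).1 t = (u n).1 t := by
    intro n k t ht
    induction k with
    | zero => rfl
    | succ k ih =>
      rw [← ih, ← add_assoc]
      refine hstab _ t (ht.trans ?_)
      gcongr
      simp
  obtain ⟨χ, hχ, θ, hθ, hlim⟩ := hX.isCompact_bebCore.tendsto_subseq fun n => (u n).2.1
  have heval : ∀ n : ℕ, ∀ t : ℝ≥0, t ≤ n * d → χ t = (u n).1 t := by
    intro n t ht
    have h1 : Tendsto (fun k => (u (θ k)).1 t) atTop (𝓝 (χ t)) :=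
      ((continuous_eval_const t).tendsto χ).comp hlim
    refine tendsto_nhds_unique h1 (tendsto_const_nhds.congr' ?_)
    filter_upwards [hθ.tendsto_atTop.eventually_ge_atTop n] with k hk
    obtain ⟨j, hj⟩ := exists_add_of_le hk
    rw [hj, hstab' n j t ht]
  have hper : ∀ t, χ (t + d) = χ t := by
    intro t
    obtain ⟨n, hn⟩ := exists_nat_ge (t / d)
    rw [div_le_iff₀ hd] at hn
    rw [heval n t hn, heval (n + 1) (t + d) (by push_cast; rw [add_mul, one_mul]; gcongr), hu,
      add_comm t d, hF2]
  have hinit : ∀ t ≤ d, χ t = ψ t := fun t ht => by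
    rw [heval 1 t (by simpa using ht), hu, hF1 _ t ht]
  refine ⟨χ, hχ, hper, hinit 0 zero_le, fun t => ?_⟩
  have key : ∀ n : ℕ, ∀ t : ℝ≥0, t ≤ n * d → ∃ s ≤ d, χ t = ψ s := by
    intro n
    induction n with
    | zero =>
      intro t ht
      have : t = 0 := by simpa using ht
      exact ⟨0, zero_le, by rw [this, hinit 0 zero_le]⟩
    | succ n ih =>
      intro t ht
      rcases le_total t d with htd | htd
      · exact ⟨t, htd, hinit t htd⟩
      · obtain ⟨s, rfl⟩ := exists_add_of_le htd
        rw [add_comm d s, hper]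
        refine ih s ?_
        push_cast at ht
        rw [add_mul, one_mul, add_comm] at ht
        exact le_of_add_le_add_right ht
  obtain ⟨n, hn⟩ := exists_nat_ge (t / d)
  rw [div_le_iff₀ hd] at hn
  exact key n t hn

theorem exists_preperiodic (hX : IsSwitchedBebutovShift X) {φ : C(ℝ≥0, Z)} (hφ : φ ∈ bebCore X)
    (hinj : ¬ Function.Injective φ) :
    ∃ χ ∈ X, (∃ T p : ℝ≥0, 0 < p ∧ ∀ t : ℝ≥0, T ≤ t → χ (t + p) = χ t) ∧ χ 0 = φ 0 := by
  obtain ⟨a, b, hab, heq⟩ : ∃ a b, a < b ∧ φ a = φ b := by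
    simp only [Function.Injective, not_forall] at hinj
    obtain ⟨a, b, heq, hne⟩ := hinj
    rcases lt_or_gt_of_ne hne with h | h
    · exact ⟨a, b, h, heq⟩
    · exact ⟨b, a, h, heq.symm⟩
  obtain ⟨ξ, hξ, hper, h0, -⟩ := hX.exists_periodic (hX.bebShift_mem_bebCore hφ a) (d := b - a)
    (tsub_pos_of_lt hab) (by simp [tsub_add_cancel_of_le hab.le, heq])
  obtain ⟨χ, hχ, h1, h2⟩ := hX.exists_concat hφ hξ (τ₁ := a) (τ₂ := 0) (by simp [h0])
  refine ⟨χ, bebCore_subset hχ, ⟨a, b - a, tsub_pos_of_lt hab, fun t ht => ?_⟩, h1 0 zero_le⟩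
  obtain ⟨s, rfl⟩ := exists_add_of_le ht
  rw [add_assoc, h2, h2, zero_add, zero_add, hper]

/-- If no element of the core is constantly `p`, then all of them leave a fixed neighborhood of `p`
within a uniform time. -/
theorem exists_uniform_exit (hX : IsSwitchedBebutovShift X) {p : Z}
    (hp : ∀ χ ∈ bebCore X, ∃ t, χ t ≠ p) :
    ∃ ρ > 0, ∃ T : ℝ≥0, ∀ ψ ∈ bebCore X, ∃ t ≤ T, ρ < dist (ψ t) p := by
  by_contra! hno
  have h : ∀ n : ℕ, ∃ ψ ∈ bebCore X, ∀ t : ℝ≥0, t ≤ n → dist (ψ t) p ≤ 1 / ((n : ℝ) + 1) :=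
    fun n => hno _ (by positivity) n
  choose ψ hψ hψ' using h
  obtain ⟨χ, hχ, θ, hθ, hlim⟩ := hX.isCompact_bebCore.tendsto_subseq hψ
  obtain ⟨t, ht⟩ := hp χ hχ
  have h1 : Tendsto (fun k => ψ (θ k) t) atTop (𝓝 (χ t)) :=
    ((continuous_eval_const t).tendsto χ).comp hlim
  refine ht (tendsto_nhds_unique h1 (tendsto_iff_dist_tendsto_zero.2 ?_))
  refine squeeze_zero' (Eventually.of_forall fun _ => dist_nonneg) ?_
    (tendsto_one_div_add_atTop_nhds_zero_nat.comp hθ.tendsto_atTop)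
  obtain ⟨n, hn⟩ := exists_nat_ge t
  filter_upwards [hθ.tendsto_atTop.eventually_ge_atTop n] with k hk
  exact hψ' _ t (hn.trans (by exact_mod_cast hk))

/-- There is no family of almost closed pieces in a neighborhood which all elements of the core
leave. -/
theorem false_of_returns (hX : IsSwitchedBebutovShift X) {p : Z} {ρ : ℝ} {T : ℝ≥0}
    (hexit : ∀ ψ ∈ bebCore X, ∃ t ≤ T, ρ < dist (ψ t) p) {φ : C(ℝ≥0, Z)} (hφ : φ ∈ bebCore X)
    {a₀ a₁ : ℝ≥0} (ha : a₀ < a₁) (harc : ∀ t, a₀ ≤ t → t ≤ a₁ → dist (φ t) p ≤ ρ)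
    (hret : ∀ ε > 0, ∃ u v : ℝ≥0, u ≤ v ∧ dist (φ u) (φ a₁) ≤ ε ∧ dist (φ v) (φ a₀) ≤ ε ∧
      ∀ w, u ≤ w → w ≤ v → dist (φ w) p ≤ ρ) : False := by
  choose u v huv hu hv hw using fun n : ℕ => hret (1 / ((n : ℝ) + 1)) (by positivity)
  have hvT : ∀ n, v n - u n ≤ T := by
    intro n
    by_contra! hlt
    obtain ⟨t, ht, htρ⟩ := hexit _ (hX.bebShift_mem_bebCore hφ (u n))
    refine absurd (hw n (t + u n) (by simp) ?_) (not_le.2 htρ)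
    exact (lt_tsub_iff_right.1 (ht.trans_lt hlt)).le
  obtain ⟨⟨ψ, d⟩, ⟨hψ, -⟩, θ, hθ, hlim⟩ :=
    (hX.isCompact_bebCore.prod (isCompact_Icc (a := (0 : ℝ≥0)) (b := T))).tendsto_subseq
      (x := fun n => (bebShift (u n) φ, v n - u n))
      fun n => ⟨hX.bebShift_mem_bebCore hφ (u n), ⟨zero_le, hvT n⟩⟩
  have hlim1 : Tendsto (fun k => bebShift (u (θ k)) φ) atTop (𝓝 ψ) :=
    (continuous_fst.tendsto (ψ, d)).comp hlim
  have hlim2 : Tendsto (fun k => v (θ k) - u (θ k)) atTop (𝓝 d) :=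
    (continuous_snd.tendsto (ψ, d)).comp hlim
  have hev : ∀ t, Tendsto (fun k => φ (t + u (θ k))) atTop (𝓝 (ψ t)) := fun t =>
    ((continuous_eval_const t).tendsto ψ).comp hlim1
  have hsmall : Tendsto (fun k => 1 / ((θ k : ℝ) + 1)) atTop (𝓝 0) :=
    tendsto_one_div_add_atTop_nhds_zero_nat.comp hθ.tendsto_atTop
  have hψ0 : ψ 0 = φ a₁ := by
    refine tendsto_nhds_unique (hev 0) (tendsto_iff_dist_tendsto_zero.2 ?_)
    refine squeeze_zero (fun _ => dist_nonneg) (fun k => ?_) hsmall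
    rw [zero_add]
    exact hu _
  have hψd : ψ d = φ a₀ := by
    have h1 : Tendsto (fun k => bebShift (u (θ k)) φ (v (θ k) - u (θ k))) atTop (𝓝 (ψ d)) :=
      ((by fun_prop : Continuous fun q : C(ℝ≥0, Z) × ℝ≥0 => q.1 q.2).tendsto (ψ, d)).comp hlim
    refine tendsto_nhds_unique h1 (tendsto_iff_dist_tendsto_zero.2 ?_)
    refine squeeze_zero (fun _ => dist_nonneg) (fun k => ?_) hsmall
    rw [bebShift_apply, tsub_add_cancel_of_le (huv _)]
    exact hv _
  have hψρ : ∀ t ≤ d, dist (ψ t) p ≤ ρ := by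
    intro t ht
    rcases ht.eq_or_lt with rfl | hlt
    · rw [hψd]
      exact harc _ le_rfl ha.le
    · refine le_of_tendsto ((hev t).dist tendsto_const_nhds) ?_
      filter_upwards [hlim2.eventually (lt_mem_nhds hlt)] with k hk
      exact hw _ _ (by simp) (lt_tsub_iff_right.1 hk).le
  obtain ⟨χ, hχ, h1, h2⟩ := hX.exists_concat hψ hφ hψd
  obtain ⟨ξ, hξ, -, -, hval⟩ := hX.exists_periodic hχ (d := d + (a₁ - a₀))
    (add_pos_of_nonneg_of_pos zero_le (tsub_pos_of_lt ha))
    (by rw [h2, add_tsub_cancel_of_le ha.le, h1 0 zero_le, hψ0])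
  obtain ⟨t, -, ht⟩ := hexit ξ hξ
  obtain ⟨s, hs, hs'⟩ := hval t
  rw [hs'] at ht
  refine absurd ht (not_lt.2 ?_)
  rcases le_total s d with hsd | hsd
  · rw [h1 s hsd]
    exact hψρ s hsd
  · obtain ⟨r, rfl⟩ := exists_add_of_le hsd
    rw [h2]
    refine harc _ (by simp) ?_
    have h3 : r ≤ a₁ - a₀ := le_of_add_le_add_left hs
    rw [← add_tsub_cancel_of_le ha.le]
    gcongr

end IsSwitchedBebutovShift

end BebutovDynamics

theorem exists_planar_chart
    (v : Metric.sphere (0 : EuclideanSpace ℝ (Fin 3)) 1) :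
    ∃ (f : {x : Metric.sphere (0 : EuclideanSpace ℝ (Fin 3)) 1 // x ≠ v} → ℂ)
      (g : ℂ → Metric.sphere (0 : EuclideanSpace ℝ (Fin 3)) 1),
      Continuous f ∧ Continuous g ∧ ∀ x, g (f x) = x := by
  have : Fact (Module.finrank ℝ (EuclideanSpace ℝ (Fin 3)) = 2 + 1) := ⟨by simp⟩
  let i := Complex.orthonormalBasisOneI.repr
  refine ⟨fun x => i.symm (stereographic' 2 v x), fun z => (stereographic' 2 v).symm (i z),
    ?_, ?_, fun x => ?_⟩
  · refine i.symm.continuous.comp ((stereographic' 2 v).continuousOn.comp_continuous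
      continuous_subtype_val fun x => ?_)
    rw [stereographic'_source]
    exact x.2
  · refine (stereographic' 2 v).symm.continuousOn.comp_continuous i.continuous fun x => ?_
    simp
  · simp only [LinearIsometryEquiv.apply_symm_apply]
    refine (stereographic' 2 v).left_inv ?_
    rw [stereographic'_source]
    exact x.2

/-- A recurrent injective curve in the sphere makes almost closed returns near its initial point. -/
theorem exists_sphere_returns {Z : Set (EuclideanSpace ℝ (Fin 3))}
    (hZs : Z ⊆ Metric.sphere (0 : EuclideanSpace ℝ (Fin 3)) 1) {φ : C(ℝ≥0, Z)}
    (hrec : IsShiftRecurrent φ) (hinj : Function.Injective φ) {ρ : ℝ} (hρ : 0 < ρ) :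
    ∃ a₀ a₁ : ℝ≥0, a₀ < a₁ ∧ (∀ t, a₀ ≤ t → t ≤ a₁ → dist (φ t) (φ 0) ≤ ρ) ∧
      ∀ ε > 0, ∃ u v : ℝ≥0, u ≤ v ∧ dist (φ u) (φ a₁) ≤ ε ∧ dist (φ v) (φ a₀) ≤ ε ∧
        ∀ w, u ≤ w → w ≤ v → dist (φ w) (φ 0) ≤ ρ := by
  obtain ⟨δ, hδ, hδρ⟩ := Metric.continuousAt_iff.1 (φ.continuous.continuousAt (x := 0)) (ρ / 2)
    (half_pos hρ)
  obtain ⟨c, hc, hcδ⟩ : ∃ c : ℝ≥0, 0 < c ∧ 2 * (c : ℝ) < δ :=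
    ⟨(δ / 4).toNNReal, Real.toNNReal_pos.2 (by positivity), by
      rw [Real.coe_toNNReal _ (by positivity)]
      linarith⟩
  have hcR : (0 : ℝ) < c := NNReal.coe_pos.2 hc
  have harc : ∀ r : ℝ≥0, r ≤ c → dist (φ (r + c)) (φ 0) < ρ / 2 := fun r hr => hδρ (by
    rw [NNReal.dist_eq, NNReal.coe_zero, sub_zero, abs_of_nonneg (NNReal.coe_nonneg _)]
    push_cast
    have : (r : ℝ) ≤ c := hr
    linarith)
  set p : Metric.sphere (0 : EuclideanSpace ℝ (Fin 3)) 1 := ⟨φ 0, hZs (φ 0).2⟩ with hp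
  obtain ⟨f, g, hf, hg, hgf⟩ := exists_planar_chart p
  let y : C(ℝ≥0, {x : Metric.sphere (0 : EuclideanSpace ℝ (Fin 3)) 1 // x ≠ p}) :=
    ⟨fun t => ⟨⟨φ (t + c), hZs (φ (t + c)).2⟩, fun h => by
      have h1 : φ (t + c) = φ 0 := Subtype.ext (Subtype.mk.inj h)
      have h2 := hinj h1
      exact hc.ne' (add_eq_zero.1 h2).2⟩, by fun_prop⟩
  have hgy : ∀ t, (g (f (y t)) : EuclideanSpace ℝ (Fin 3)) = φ (t + c) := fun t => by
    rw [hgf]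
    rfl
  obtain ⟨τ, hτ, hτφ⟩ := hrec
  have hlim : Tendsto (fun n => (⟨f, hf⟩ : C(_, ℂ)).comp (bebShift (τ n) y)) atTop
      (𝓝 ((⟨f, hf⟩ : C(_, ℂ)).comp y)) := by
    refine ((ContinuousMap.continuous_postcomp (⟨f, hf⟩ : C(_, ℂ))).tendsto y).comp ?_
    let j : C({x : Metric.sphere (0 : EuclideanSpace ℝ (Fin 3)) 1 // x ≠ p},
      EuclideanSpace ℝ (Fin 3)) := ⟨fun x => x.1.1, by fun_prop⟩
    have hj : IsInducing j := IsInducing.subtypeVal.comp IsInducing.subtypeVal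
    rw [(ContinuousMap.isInducing_postcomp j hj).tendsto_nhds_iff]
    have h1 := ((ContinuousMap.continuous_postcomp
      (⟨Subtype.val, continuous_subtype_val⟩ : C(Z, EuclideanSpace ℝ (Fin 3)))).comp
        (continuous_bebShift c)).tendsto φ |>.comp hτφ
    refine h1.congr fun n => ?_
    ext t : 1
    change (φ (t + c + τ n) : EuclideanSpace ℝ (Fin 3)) = φ (t + τ n + c)
    rw [add_right_comm]
  rw [ContinuousMap.tendsto_iff_forall_isCompact_tendstoUniformlyOn] at hlim
  let F : ℝ → ℂ := fun r => f (y r.toNNReal)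
  have hF : Continuous F := hf.comp (y.continuous.comp continuous_real_toNNReal)
  have hFinj : Set.InjOn F (Set.Ici 0) := by
    intro a ha b hb hab
    have h1 : φ (a.toNNReal + c) = φ (b.toNNReal + c) := Subtype.ext (by
      rw [← hgy, ← hgy]
      exact congrArg (fun z => (g z : EuclideanSpace ℝ (Fin 3))) hab)
    have h2 := add_right_cancel (hinj h1)
    exact (Real.toNNReal_eq_toNNReal_iff ha hb).1 h2
  have hFrec : ∀ ε > 0, ∀ T, ∃ t ≥ T, ∀ r ∈ Set.Icc 0 (c : ℝ), ‖F (r + t) - F r‖ ≤ ε := by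
    intro ε hε T
    have h1 := Metric.tendstoUniformlyOn_iff.1 (hlim (Set.Icc 0 c) isCompact_Icc) ε hε
    obtain ⟨n, hn, hnT⟩ := (h1.and (hτ.eventually_ge_atTop T.toNNReal)).exists
    refine ⟨τ n, (Real.le_coe_toNNReal T).trans hnT, fun r hr => ?_⟩
    have h2 := hn r.toNNReal ⟨zero_le, Real.toNNReal_le_iff_le_coe.2 hr.2⟩
    rw [dist_eq_norm, norm_sub_rev] at h2
    have h3 : (r + τ n).toNNReal = r.toNNReal + τ n := by
      rw [Real.toNNReal_add hr.1 (NNReal.coe_nonneg _), Real.toNNReal_coe]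
    change ‖f (y (r + τ n).toNNReal) - f (y r.toNNReal)‖ ≤ ε
    rw [h3]
    exact h2.le
  have hret : ∀ η > 0, ∃ u v, 0 ≤ u ∧ u ≤ v ∧ ‖F u - F (2 * c / 3)‖ < η ∧ ‖F v - F (c / 3)‖ < η ∧
      ∀ w ∈ Set.Icc u v, ∃ r ∈ Set.Icc 0 (c : ℝ), ‖F w - F r‖ < η := fun η hη =>
    exists_return hF hFinj (by positivity) (by linarith) (by linarith) hη hFrec
  have hunif : ∀ ε > 0, ∃ η > 0, ∀ r ∈ Set.Icc 0 (c : ℝ), ∀ w, ‖F w - F r‖ < η →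
      dist (φ (w.toNNReal + c)) (φ (r.toNNReal + c)) < ε := by
    intro ε hε
    have h1 :=
      (isCompact_Icc.image hF : IsCompact (F '' Set.Icc 0 (c : ℝ))).uniformContinuousAt_of_continuousAt
      g (fun a _ => hg.continuousAt) (Metric.dist_mem_uniformity hε)
    obtain ⟨η, hη, h2⟩ := Metric.mem_uniformity_dist.1 h1
    refine ⟨η, hη, fun r hr w hw => ?_⟩
    have h3 := h2 (a := F r) (b := F w) (by rwa [dist_eq_norm, norm_sub_rev]) ⟨r, hr, rfl⟩
    rw [dist_comm, Subtype.dist_eq, ← hgy, ← hgy]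
    exact h3
  have hmem0 : (c : ℝ) / 3 ∈ Set.Icc 0 (c : ℝ) := ⟨by positivity, by linarith⟩
  have hmem1 : 2 * (c : ℝ) / 3 ∈ Set.Icc 0 (c : ℝ) := ⟨by positivity, by linarith⟩
  refine ⟨(c / 3 : ℝ).toNNReal + c, (2 * c / 3 : ℝ).toNNReal + c, ?_, fun t h0 h1 => ?_,
    fun ε hε => ?_⟩
  · have : (c / 3 : ℝ).toNNReal < (2 * c / 3 : ℝ).toNNReal :=
      (Real.toNNReal_lt_toNNReal_iff (by positivity)).2 (by linarith)
    gcongr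
  · obtain ⟨r, rfl⟩ := exists_add_of_le (le_add_self.trans h0 : c ≤ t)
    rw [add_comm c r] at h1 ⊢
    refine (harc r ((le_of_add_le_add_right h1).trans ?_)).le.trans (by linarith)
    exact Real.toNNReal_le_iff_le_coe.2 hmem1.2
  · obtain ⟨η, hη, hη'⟩ := hunif (min ε (ρ / 2)) (lt_min hε (half_pos hρ))
    obtain ⟨u, v, hu0, huv, hu, hv, hw⟩ := hret η hη
    refine ⟨u.toNNReal + c, v.toNNReal + c, ?_, ((hη' _ hmem1 _ hu).le.trans (min_le_left _ _)),
      ((hη' _ hmem0 _ hv).le.trans (min_le_left _ _)), fun w h1 h2 => ?_⟩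
    · gcongr
    · obtain ⟨s, rfl⟩ := exists_add_of_le (le_add_self.trans h1 : c ≤ w)
      rw [add_comm c s] at h1 h2 ⊢
      obtain ⟨r, hr, hr'⟩ := hw s ⟨Real.toNNReal_le_iff_le_coe.1 (le_of_add_le_add_right h1), by
        have h3 := NNReal.coe_le_coe.2 (le_of_add_le_add_right h2)
        rwa [Real.coe_toNNReal _ (hu0.trans huv)] at h3⟩
      have h3 := hη' r hr s hr'
      rw [Real.toNNReal_coe] at h3
      have h4 := harc r.toNNReal (Real.toNNReal_le_iff_le_coe.2 hr.2)
      have h5 := dist_triangle (φ (s + c)) (φ (r.toNNReal + c)) (φ 0)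
      linarith [min_le_right ε (ρ / 2)]

/-- Poincaré–Bendixson theorem for switched Bebutov shifts with values in a compact subset
of the unit sphere `S²` of `ℝ³`. -/
theorem switched_bebutov_sphere_preperiodic
    (Z : Set (EuclideanSpace ℝ (Fin 3))) (hZc : IsCompact Z)
    (hZs : Z ⊆ Metric.sphere (0 : EuclideanSpace ℝ (Fin 3)) 1)
    (X : Set C(ℝ≥0, Z)) (hX : IsSwitchedBebutovShift X)
    (φ : C(ℝ≥0, Z)) (hφ : φ ∈ X) (hrec : IsShiftRecurrent φ) :
    (∃ χ ∈ X, (∃ T p : ℝ≥0, 0 < p ∧ ∀ t : ℝ≥0, T ≤ t → χ (t + p) = χ t) ∧ χ 0 = φ 0) ∧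
    (Function.Injective φ → ∃ χ ∈ X, (∀ t : ℝ≥0, χ t = φ 0)) := by
  have hcore := hX.mem_bebCore_of_recurrent hφ hrec
  have hconst : Function.Injective φ → ∃ χ ∈ X, (∀ t : ℝ≥0, χ t = φ 0) := by
    intro hinj
    by_contra! hno
    obtain ⟨ρ, hρ, T, hexit⟩ := hX.exists_uniform_exit fun χ hχ => hno χ (bebCore_subset hχ)
    obtain ⟨a₀, a₁, ha, harc, hret⟩ := exists_sphere_returns hZs hrec hinj hρ
    exact hX.false_of_returns hexit hcore ha harc hret
  refine ⟨?_, hconst⟩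
  by_cases hinj : Function.Injective φ
  · obtain ⟨χ, hχ, h⟩ := hconst hinj
    exact ⟨χ, hχ, ⟨0, 1, one_pos, fun t _ => by rw [h, h]⟩, h 0⟩
  · exact hX.exists_preperiodic hcore hinj
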